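/- arXiv:1901.02486 — 3 statements merged into one kernel-verified Lean document; each statement's English description precedes it below -/
import Mathlib

section
/- Let p ∈ (0,1) and let (G_t)_{t≥1} be the preferential attachment process with edge-steps with parameter p, and set α = (1−p)/(2−p). Let 𝒯(G_t) denote the number of triangles in G_t, counted without edge multiplicities. Then there exists a positive constant C, depending only on p, such that for all t ≥ 2: E[𝒯(G_t)] ≤ C · t^{3α} · (log t)⁸. -/
open MeasureTheory Filter

attribute [local instance] Classical.propDecidable

/-- Degree of vertex `i` at time `t` computed from the endpoint process `ep`:
the edge added at step `s` contributes `1` for each of its endpoints equal to `i`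
(so a loop at `i` contributes `2`). -/
noncomputable def degOf {Ω : Type} (ep : ℕ → Ω → ℕ × ℕ) (t i : ℕ) (ω : Ω) : ℕ :=
  ∑ s ∈ Finset.Icc 1 t,
    ((if (ep s ω).1 = i then 1 else 0) + (if (ep s ω).2 = i then 1 else 0))

/-- The preferential attachment random graph process with edge-steps and parameter `p`.
`G_1` is a single vertex (labeled `1`) with a loop.  At each step `t + 1` (for `t ≥ 1`),
with probability `p` a vertex-step occurs: a new vertex `nv t + 1` is added together with an
edge to an old vertex `u`, chosen with probability `d_t(u) / (2t)`; with probability `1 - p`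
an edge-step occurs: an edge `{u, w}` is added, where `u` and `w` are chosen independently,
each with probability proportional to its degree.  The field `ep t` records the (ordered pair
of) endpoints of the unique edge added at step `t`, `nv t` is the number of vertices of `G_t`,
and `Z t` tells whether step `t` was a vertex-step.  The one-step conditional laws are
prescribed via conditional expectations with respect to a filtration `ℱ` to which the process
is adapted. -/
structure PAProcess (p : ℝ) where
  Ω : Type
  m0 : MeasurableSpace Ω
  μ : Measure Ω
  isProb : IsProbabilityMeasure μ
  ℱ : Filtration ℕ m0
  Z : ℕ → Ω → Bool
  nv : ℕ → Ω → ℕ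
  ep : ℕ → Ω → ℕ × ℕ
  nv_one : ∀ ω, nv 1 ω = 1
  ep_one : ∀ ω, ep 1 ω = (1, 1)
  nv_succ : ∀ t, 1 ≤ t → ∀ ω, nv (t + 1) ω = nv t ω + (if Z (t + 1) ω then 1 else 0)
  ep_vertexStep : ∀ t, 1 ≤ t → ∀ ω, Z (t + 1) ω = true →
    (ep (t + 1) ω).2 = nv t ω + 1 ∧ 1 ≤ (ep (t + 1) ω).1 ∧ (ep (t + 1) ω).1 ≤ nv t ω
  ep_edgeStep : ∀ t, 1 ≤ t → ∀ ω, Z (t + 1) ω = false →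
    1 ≤ (ep (t + 1) ω).1 ∧ (ep (t + 1) ω).1 ≤ nv t ω ∧
    1 ≤ (ep (t + 1) ω).2 ∧ (ep (t + 1) ω).2 ≤ nv t ω
  Z_meas : ∀ t, Measurable[ℱ t] (Z t)
  nv_meas : ∀ t, Measurable[ℱ t] (nv t)
  ep_meas : ∀ t, Measurable[ℱ t] (ep t)
  condLaw_Z : ∀ t, 1 ≤ t →
    μ[Set.indicator {ω | Z (t + 1) ω = true} (fun _ => (1 : ℝ)) | ℱ t] =ᵐ[μ] fun _ => p
  condLaw_vertex : ∀ t, 1 ≤ t → ∀ u,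
    μ[Set.indicator {ω | Z (t + 1) ω = true ∧ ep (t + 1) ω = (u, nv t ω + 1)}
        (fun _ => (1 : ℝ)) | ℱ t]
      =ᵐ[μ] fun ω => p * (degOf ep t u ω : ℝ) / (2 * t)
  condLaw_edge : ∀ t, 1 ≤ t → ∀ u w,
    μ[Set.indicator {ω | Z (t + 1) ω = false ∧ ep (t + 1) ω = (u, w)}
        (fun _ => (1 : ℝ)) | ℱ t]
      =ᵐ[μ] fun ω => (1 - p) * (degOf ep t u ω : ℝ) * (degOf ep t w ω : ℝ) / (2 * t) ^ 2

namespace PAProcess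

variable {p : ℝ} (P : PAProcess p)

/-- degree `d_t(i)` of vertex `i` in `G_t` (`0` if `i` is not yet present). -/
noncomputable def deg (t i : ℕ) (ω : P.Ω) : ℕ := degOf P.ep t i ω

/-- `i` and `j` are joined by at least one edge in `G_t`. -/
def Joined (t i j : ℕ) (ω : P.Ω) : Prop :=
  ∃ s ∈ Finset.Icc 1 t, P.ep s ω = (i, j) ∨ P.ep s ω = (j, i)

/-- number of triangles of `G_t`: sets of three distinct vertices pairwise joined by at
least one edge (counted without edge multiplicities). -/
noncomputable def triangles (t : ℕ) (ω : P.Ω) : ℕ :=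
  ((Finset.Icc 1 t ×ˢ Finset.Icc 1 t ×ˢ Finset.Icc 1 t).filter
    (fun q => q.1 < q.2.1 ∧ q.2.1 < q.2.2 ∧ P.Joined t q.1 q.2.1 ω ∧
      P.Joined t q.1 q.2.2 ω ∧ P.Joined t q.2.1 q.2.2 ω)).card

/-- number of cherries (paths of length 2) of `G_t`: unordered pairs of distinct edges of
`G_t` sharing a common endpoint.  The edges of `G_t` are indexed by their creation times
`1 ≤ s ≤ t`. -/
noncomputable def cherries (t : ℕ) (ω : P.Ω) : ℕ :=
  ((Finset.Icc 1 t ×ˢ Finset.Icc 1 t).filter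
    (fun q => q.1 < q.2 ∧
      ((P.ep q.1 ω).1 = (P.ep q.2 ω).1 ∨ (P.ep q.1 ω).1 = (P.ep q.2 ω).2 ∨
       (P.ep q.1 ω).2 = (P.ep q.2 ω).1 ∨ (P.ep q.1 ω).2 = (P.ep q.2 ω).2))).card

/-- global clustering coefficient of `G_t`. -/
noncomputable def clustering (t : ℕ) (ω : P.Ω) : ℝ :=
  3 * (P.triangles t ω : ℝ) / (P.cherries t ω : ℝ)

/-- clique number of `G_t`: the largest `k` such that `G_t` contains `k` distinct vertices
pairwise joined by at least one edge. -/
noncomputable def cliqueNum (t : ℕ) (ω : P.Ω) : ℕ :=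
  sSup {k | ∃ S : Finset ℕ, S ⊆ Finset.Icc 1 (P.nv t ω) ∧ S.card = k ∧
    ∀ i ∈ S, ∀ j ∈ S, i ≠ j → P.Joined t i j ω}

/-- `Γ_t(j)`: the number of distinct vertices joined to `j` by at least one edge in `G_t`. -/
noncomputable def nbrCount (t j : ℕ) (ω : P.Ω) : ℕ :=
  ((Finset.Icc 1 t).filter (fun i => P.Joined t i j ω)).card

/-- the time at which vertex `j` is added to the graph. -/
noncomputable def addTime (j : ℕ) (ω : P.Ω) : ℕ := sInf {t | P.nv t ω = j}

/-- at step `s` an edge joining `i` and `j` is added by an edge-step. -/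
def EdgeStepEdge (s i j : ℕ) (ω : P.Ω) : Prop :=
  2 ≤ s ∧ P.Z s ω = false ∧ (P.ep s ω = (i, j) ∨ P.ep s ω = (j, i))

/-- at step `s` an edge joining `i` and `j` is added by a vertex-step. -/
def VertexStepEdge (s i j : ℕ) (ω : P.Ω) : Prop :=
  2 ≤ s ∧ P.Z s ω = true ∧ (P.ep s ω = (i, j) ∨ P.ep s ω = (j, i))

/-- at step `s` vertex `j` is added by a vertex-step and its attaching edge connects it
to vertex `i`. -/
def AttachEdge (s i j : ℕ) (ω : P.Ω) : Prop :=
  2 ≤ s ∧ P.Z s ω = true ∧ P.ep s ω = (i, j) ∧ P.nv s ω = j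

/-- `i` and `j` are joined in `G_t` by at least one edge created at an edge-step. -/
def EdgeJoined (t i j : ℕ) (ω : P.Ω) : Prop :=
  ∃ s ∈ Finset.Icc 1 t, P.EdgeStepEdge s i j ω

/-- `i` and `j` are joined in `G_t` by at least one edge created at a vertex-step. -/
def VJoined (t i j : ℕ) (ω : P.Ω) : Prop :=
  ∃ s ∈ Finset.Icc 1 t, P.VertexStepEdge s i j ω

/-- `i` and `j` are joined in `G_t`, and exclusively by edges created at vertex-steps. -/
def OnlyVertexJoined (t i j : ℕ) (ω : P.Ω) : Prop :=
  P.Joined t i j ω ∧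
    ∀ s ∈ Finset.Icc 1 t, (P.ep s ω = (i, j) ∨ P.ep s ω = (j, i)) → P.Z s ω = true

end PAProcess

section ScalarSums

open Real

theorem sum_Icc_rpow_neg_le {r : ℝ} (hr0 : 0 ≤ r) (hr1 : r < 1) (n : ℕ) :
    ∑ i ∈ Finset.Icc 1 n, (i : ℝ) ^ (-r) ≤ (n : ℝ) ^ (1 - r) / (1 - r) := by
  have h1 : 0 < 1 - r := by linarith
  induction n with
  | zero => simp [zero_rpow h1.ne']
  | succ n ih =>
    rw [Finset.sum_Icc_succ_top (by omega)]
    have hy : (0 : ℝ) < (n : ℝ) + 1 := by positivity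
    have hb := rpow_one_add_le_one_add_mul_self (s := -(1 / ((n : ℝ) + 1)))
      (by rw [neg_le_neg_iff, div_le_one hy]; linarith [(Nat.cast_nonneg n : (0 : ℝ) ≤ n)])
      h1.le (by linarith)
    have hfac : (n : ℝ) ^ (1 - r) =
        ((n : ℝ) + 1) ^ (1 - r) * (1 + -(1 / ((n : ℝ) + 1))) ^ (1 - r) := by
      have h0 : 0 ≤ 1 + -(1 / ((n : ℝ) + 1)) := by
        have : 1 / ((n : ℝ) + 1) ≤ 1 := by
          rw [div_le_one hy]; linarith [(Nat.cast_nonneg n : (0 : ℝ) ≤ n)]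
        linarith
      rw [← mul_rpow hy.le h0]
      congr 1
      field_simp
      ring
    have hpow : ((n : ℝ) + 1) ^ (-r) = ((n : ℝ) + 1) ^ (1 - r) / ((n : ℝ) + 1) := by
      rw [show -r = (1 - r) - 1 by ring, rpow_sub_one hy.ne']
    have hpos : 0 < ((n : ℝ) + 1) ^ (1 - r) := rpow_pos_of_pos hy _
    have hstep : (n : ℝ) ^ (1 - r) ≤
        ((n : ℝ) + 1) ^ (1 - r) - (1 - r) * ((n : ℝ) + 1) ^ (-r) := by
      rw [hfac, hpow]
      calc _ ≤ ((n : ℝ) + 1) ^ (1 - r) * (1 + (1 - r) * -(1 / ((n : ℝ) + 1))) :=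
            mul_le_mul_of_nonneg_left hb hpos.le
        _ = _ := by ring
    push_cast
    rw [le_div_iff₀ h1] at ih ⊢
    linarith

theorem sum_Ioc_rpow_neg_le {δ : ℝ} (hδ : 0 < δ) {m : ℕ} (hm : 1 ≤ m) (n : ℕ) (hmn : m ≤ n) :
    ∑ i ∈ Finset.Ioc m n, (i : ℝ) ^ (-(1 + δ)) ≤ ((m : ℝ) ^ (-δ) - (n : ℝ) ^ (-δ)) / δ := by
  induction n, hmn using Nat.le_induction with
  | base => simp
  | succ n hn ih =>
    rw [Finset.sum_Ioc_succ_top (by omega)]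
    have hn0 : (0 : ℝ) < n := by exact_mod_cast (by omega : 0 < n)
    have hy : (0 : ℝ) < (n : ℝ) + 1 := by positivity
    have hpos : 0 < ((n : ℝ) + 1) ^ (-δ) := rpow_pos_of_pos hy _
    have hpow : ((n : ℝ) + 1) ^ (-(1 + δ)) = ((n : ℝ) + 1) ^ (-δ) / ((n : ℝ) + 1) := by
      rw [show -(1 + δ) = -δ - 1 by ring, rpow_sub_one hy.ne']
    have hfac : (n : ℝ) ^ (-δ) = ((n : ℝ) + 1) ^ (-δ) * ((n : ℝ) / ((n : ℝ) + 1)) ^ (-δ) := by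
      rw [← mul_rpow hy.le (by positivity)]
      congr 1
      field_simp
    have hlog : log ((n : ℝ) / ((n : ℝ) + 1)) ≤ -(1 / ((n : ℝ) + 1)) := by
      have := log_le_sub_one_of_pos (show 0 < (n : ℝ) / ((n : ℝ) + 1) by positivity)
      have h2 : (n : ℝ) / ((n : ℝ) + 1) - 1 = -(1 / ((n : ℝ) + 1)) := by field_simp; ring
      linarith
    have hge : 1 + δ / ((n : ℝ) + 1) ≤ ((n : ℝ) / ((n : ℝ) + 1)) ^ (-δ) := by
      rw [rpow_def_of_pos (by positivity)]
      have h3 := add_one_le_exp (log ((n : ℝ) / ((n : ℝ) + 1)) * -δ)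
      have h4 : δ * (1 / ((n : ℝ) + 1)) ≤ log ((n : ℝ) / ((n : ℝ) + 1)) * -δ := by
        nlinarith
      have h5 : δ / ((n : ℝ) + 1) = δ * (1 / ((n : ℝ) + 1)) := by ring
      linarith
    have hstep : ((n : ℝ) + 1) ^ (-δ) + δ * ((n : ℝ) + 1) ^ (-(1 + δ)) ≤ (n : ℝ) ^ (-δ) := by
      rw [hfac, hpow]
      calc _ = ((n : ℝ) + 1) ^ (-δ) * (1 + δ / ((n : ℝ) + 1)) := by ring
        _ ≤ _ := mul_le_mul_of_nonneg_left hge hpos.le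
    push_cast
    rw [le_div_iff₀ hδ] at ih ⊢
    linarith

theorem sum_Icc_one_div_le (n : ℕ) : ∑ i ∈ Finset.Icc 1 n, 1 / (i : ℝ) ≤ 1 + log n := by
  have h := harmonic_le_one_add_log n
  rw [harmonic_eq_sum_Icc] at h
  push_cast at h
  simpa [one_div] using h

theorem sum_Icc_one_div_sq_le (n : ℕ) : ∑ i ∈ Finset.Icc 1 n, 1 / (i : ℝ) ^ 2 ≤ 2 := by
  have h := sum_Ioo_inv_sq_le (α := ℝ) 0 (n + 1)
  have h2 : Finset.Ioo 0 (n + 1) = Finset.Icc 1 n := by ext; simp; omega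
  rw [h2] at h
  simpa [one_div] using h

end ScalarSums

section OneStep

open Real

theorem sum_mul_prod_add_mul {ι κ : Type*} (O : Finset κ) (W : κ → ℝ) (S : Finset ι)
    (N c : ι → ℝ) (z : κ → ι → ℝ) :
    ∑ o ∈ O, W o * ∏ e ∈ S, (N e + c e * z o e) =
      ∑ A ∈ S.powerset, ((∏ e ∈ A, N e) * ∏ e ∈ S \ A, c e) *
        ∑ o ∈ O, W o * ∏ e ∈ S \ A, z o e := by
  simp_rw [Finset.prod_add, Finset.prod_mul_distrib, Finset.mul_sum]
  rw [Finset.sum_comm]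
  refine Finset.sum_congr rfl fun A _ => Finset.sum_congr rfl fun o _ => ?_
  ring

/-- A product of affine functions of nonnegative random factors has expectation controlled by
the expectations of the products of these factors. -/
theorem sum_mul_prod_add_mul_le {ι κ κ' : Type*} (O : Finset κ) (W : κ → ℝ) (O' : Finset κ')
    (W' : κ' → ℝ) (S : Finset ι) (N c : ι → ℝ) (z : κ → ι → ℝ) (z' : κ' → ι → ℝ) (K : ℝ)
    (hN : ∀ e ∈ S, 0 ≤ N e) (hc : ∀ e ∈ S, 0 ≤ c e)
    (h : ∀ A ⊆ S, ∑ o ∈ O, W o * ∏ e ∈ A, z o e + ∑ o ∈ O', W' o * ∏ e ∈ A, z' o e ≤ K) :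
    ∑ o ∈ O, W o * ∏ e ∈ S, (N e + c e * z o e) +
      ∑ o ∈ O', W' o * ∏ e ∈ S, (N e + c e * z' o e) ≤ K * ∏ e ∈ S, (N e + c e) := by
  rw [sum_mul_prod_add_mul, sum_mul_prod_add_mul, ← Finset.sum_add_distrib, Finset.prod_add,
    Finset.mul_sum]
  refine Finset.sum_le_sum fun A hA => ?_
  rw [← mul_add, mul_comm K]
  refine mul_le_mul_of_nonneg_left (h _ Finset.sdiff_subset) (mul_nonneg ?_ ?_)
  · exact Finset.prod_nonneg fun e he => hN e (Finset.mem_powerset.1 hA he)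
  · exact Finset.prod_nonneg fun e he => hc e (Finset.sdiff_subset he)

theorem prod_add_le_prod_add_sum {ι : Type*} (S : Finset ι) (hS : S.card ≤ 3) (ξ g : ι → ℝ)
    (hξ0 : ∀ e ∈ S, 0 ≤ ξ e) (hξ : ∀ e ∈ S, ξ e ≤ 4) (hg : ∀ e ∈ S, 0 ≤ g e)
    (huniq : ∀ e ∈ S, ∀ f ∈ S, g e ≠ 0 → g f ≠ 0 → e = f) :
    ∏ e ∈ S, (ξ e + g e) ≤ ∏ e ∈ S, ξ e + 16 * ∑ e ∈ S, g e := by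
  by_cases h : ∃ e ∈ S, g e ≠ 0
  · obtain ⟨e, he, hge⟩ := h
    have hz : ∀ f ∈ S, f ≠ e → g f = 0 := by
      intro f hf hfe
      by_contra hne
      exact hfe (huniq f hf e he hne hge)
    have hrest : ∏ f ∈ S.erase e, (ξ f + g f) = ∏ f ∈ S.erase e, ξ f :=
      Finset.prod_congr rfl fun f hf => by
        rw [hz f (Finset.mem_of_mem_erase hf) (Finset.ne_of_mem_erase hf), add_zero]
    have hsum : ∑ f ∈ S, g f = g e :=
      Finset.sum_eq_single_of_mem e he fun f hf hfe => hz f hf hfe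
    have hbound : ∏ f ∈ S.erase e, ξ f ≤ 16 := by
      calc ∏ f ∈ S.erase e, ξ f ≤ ∏ f ∈ S.erase e, (4 : ℝ) :=
            Finset.prod_le_prod (fun f hf => hξ0 f (Finset.mem_of_mem_erase hf))
              (fun f hf => hξ f (Finset.mem_of_mem_erase hf))
        _ = 4 ^ (S.erase e).card := by simp
        _ ≤ 4 ^ 2 := by
            apply pow_le_pow_right₀ (by norm_num)
            rw [Finset.card_erase_of_mem he]
            omega
        _ = 16 := by norm_num
    rw [← Finset.mul_prod_erase S _ he, ← Finset.mul_prod_erase S ξ he, hrest, hsum]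
    nlinarith [hg e he]
  · push Not at h
    have h1 : ∏ e ∈ S, (ξ e + g e) = ∏ e ∈ S, ξ e :=
      Finset.prod_congr rfl fun e he => by rw [h e he, add_zero]
    rw [h1, Finset.sum_eq_zero h]
    simp

/-- Time-`s` normalisation of the degree of vertex `x`. -/
noncomputable def ageWeight (β : ℝ) (s x : ℕ) : ℝ := ((max s x : ℕ) : ℝ) ^ (-β)

/-- Degree shifted by `L`, when there are `n` vertices; vertices yet to be born get `2 * L + 2`. -/
noncomputable def shiftDeg (L : ℝ) (n : ℕ) (d : ℕ → ℝ) (x : ℕ) : ℝ :=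
  if x ≤ n then L + d x else 2 * L + 2

/-- The shifted degree after adding the edge `(v, w)`; `w = n + 1` encodes a vertex-step. -/
noncomputable def nextShiftDeg (L : ℝ) (n : ℕ) (d : ℕ → ℝ) (v w x : ℕ) : ℝ :=
  if x ≤ n then L + d x + (if v = x then 1 else 0) + (if w = x then 1 else 0)
  else if x = w then L + 1 else 2 * L + 2

/-- Indicator that the edge `(v, w)` joins the two vertices of `e`. -/
noncomputable def edgeInd (e : ℕ × ℕ) (v w : ℕ) : ℝ :=
  if (v, w) = e ∨ (v, w) = e.swap then 1 else 0

theorem edgeInd_nonneg (e : ℕ × ℕ) (v w : ℕ) : 0 ≤ edgeInd e v w := by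
  unfold edgeInd; split_ifs <;> norm_num

theorem edgeInd_le_one (e : ℕ × ℕ) (v w : ℕ) : edgeInd e v w ≤ 1 := by
  unfold edgeInd; split_ifs <;> norm_num

theorem edgeInd_unique {e f : ℕ × ℕ} (he : e.1 < e.2) (hf : f.1 < f.2) {v w : ℕ}
    (h1 : edgeInd e v w ≠ 0) (h2 : edgeInd f v w ≠ 0) : e = f := by
  unfold edgeInd at h1 h2
  simp only [ne_eq, ite_eq_right_iff, one_ne_zero, imp_false, not_not] at h1 h2
  obtain ⟨a, b⟩ := e
  obtain ⟨c, d⟩ := f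
  simp only [Prod.swap_prod_mk, Prod.mk.injEq] at *
  omega

theorem ageWeight_pos {β : ℝ} {s x : ℕ} (hs : 1 ≤ s) : 0 < ageWeight β s x :=
  rpow_pos_of_pos (by exact_mod_cast (by omega : 0 < max s x)) _

theorem ageWeight_succ_le {β : ℝ} (hβ : 0 ≤ β) {s x : ℕ} (hs : 1 ≤ s) :
    ageWeight β (s + 1) x ≤ ageWeight β s x := by
  unfold ageWeight
  apply rpow_le_rpow_of_nonpos
  · exact_mod_cast (by omega : 0 < max s x)
  · exact_mod_cast (by omega : max s x ≤ max (s + 1) x)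
  · linarith

theorem ageWeight_succ_le_exp_mul {β : ℝ} (hβ : 0 ≤ β) {s x : ℕ} (hs : 1 ≤ s) (hx : x ≤ s) :
    ageWeight β (s + 1) x ≤
      exp (-(β * (1 / (s : ℝ) - 1 / (s : ℝ) ^ 2))) * ageWeight β s x := by
  unfold ageWeight
  rw [max_eq_left hx, max_eq_left (by omega)]
  have hs0 : (0 : ℝ) < s := by exact_mod_cast hs
  push_cast
  have h1 : ((s : ℝ) + 1) ^ (-β) = (((s : ℝ) / (s + 1)) ^ β) * (s : ℝ) ^ (-β) := by
    rw [div_rpow hs0.le (by positivity), rpow_neg hs0.le, rpow_neg (by positivity)]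
    have := (rpow_pos_of_pos hs0 β).ne'
    field_simp
  rw [h1]
  refine mul_le_mul_of_nonneg_right ?_ (rpow_nonneg hs0.le _)
  rw [rpow_def_of_pos (by positivity)]
  apply exp_le_exp.2
  have hlog := log_le_sub_one_of_pos (show 0 < (s : ℝ) / (s + 1) by positivity)
  have h2 : (s : ℝ) / (s + 1) - 1 ≤ -(1 / (s : ℝ) - 1 / (s : ℝ) ^ 2) := by
    have : (s : ℝ) / (s + 1) - 1 - -(1 / (s : ℝ) - 1 / (s : ℝ) ^ 2) =
      - (1 / ((s : ℝ) ^ 2 * (s + 1))) := by field_simp; ring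
    have h3 : 0 < 1 / ((s : ℝ) ^ 2 * (s + 1)) := by positivity
    linarith
  nlinarith

end OneStep

section UnitStep

open Real

variable {p L T : ℝ} {s n : ℕ} {d : ℕ → ℝ}

/-- Growth ratio of the normalised degree of `x` when the edge `(v, w)` is added. -/
noncomputable def growthRatio (β L : ℝ) (s n : ℕ) (d : ℕ → ℝ) (v w x : ℕ) : ℝ :=
  ageWeight β (s + 1) x * nextShiftDeg L n d v w x / (ageWeight β s x * shiftDeg L n d x)

/-- Reciprocal shifted degree of a vertex already born, `0` otherwise. -/
noncomputable def invDeg (L : ℝ) (n : ℕ) (d : ℕ → ℝ) (x : ℕ) : ℝ :=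
  if x ≤ n then 1 / (L + d x) else 0

/-- Sum over the endpoints of the edges in `A` equal to `v` of their reciprocal degrees. -/
noncomputable def incidence (L : ℝ) (n : ℕ) (d : ℕ → ℝ) (A : Finset (ℕ × ℕ)) (v : ℕ) : ℝ :=
  ∑ e ∈ A, ((if v = e.1 then invDeg L n d e.1 else 0) +
    (if v = e.2 then invDeg L n d e.2 else 0))

/-- Number of endpoints of edges in `A` that are already born. -/
noncomputable def bornCount (n : ℕ) (A : Finset (ℕ × ℕ)) : ℝ :=
  ∑ e ∈ A, ((if e.1 ≤ n then (1 : ℝ) else 0) + (if e.2 ≤ n then (1 : ℝ) else 0))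

/-- The first-order drift of the logarithm of the normalisation. -/
noncomputable def ageDrift (β : ℝ) (s : ℕ) : ℝ := β * (1 / (s : ℝ) - 1 / (s : ℝ) ^ 2)

theorem shiftDeg_pos (hL : 0 < L) (hd : ∀ x, 0 ≤ d x) (x : ℕ) : 0 < shiftDeg L n d x := by
  unfold shiftDeg
  split_ifs
  · linarith [hd x]
  · linarith

theorem nextShiftDeg_nonneg (hL : 0 < L) (hd : ∀ x, 0 ≤ d x) (v w x : ℕ) :
    0 ≤ nextShiftDeg L n d v w x := by
  have := hd x
  unfold nextShiftDeg
  split_ifs <;> linarith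

theorem nextShiftDeg_le_two_mul (hL : 2 ≤ L) (hd : ∀ x, 0 ≤ d x) (v w x : ℕ) :
    nextShiftDeg L n d v w x ≤ 2 * shiftDeg L n d x := by
  have := hd x
  unfold nextShiftDeg shiftDeg
  split_ifs <;> linarith

theorem growthRatio_nonneg {β : ℝ} (hL : 0 < L) (hs : 1 ≤ s) (hd : ∀ x, 0 ≤ d x) (v w x : ℕ) :
    0 ≤ growthRatio β L s n d v w x :=
  div_nonneg (mul_nonneg (ageWeight_pos (by omega)).le (nextShiftDeg_nonneg hL hd v w x))
    (mul_nonneg (ageWeight_pos hs).le (shiftDeg_pos hL hd x).le)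

theorem growthRatio_le_two {β : ℝ} (hβ : 0 ≤ β) (hL : 2 ≤ L) (hs : 1 ≤ s) (hd : ∀ x, 0 ≤ d x)
    (v w x : ℕ) : growthRatio β L s n d v w x ≤ 2 := by
  have hdx := shiftDeg_pos (n := n) (by linarith : 0 < L) hd x
  have hw := ageWeight_pos (β := β) (x := x) hs
  unfold growthRatio
  rw [div_le_iff₀ (mul_pos hw hdx)]
  calc _ ≤ ageWeight β s x * (2 * shiftDeg L n d x) :=
        mul_le_mul (ageWeight_succ_le hβ hs) (nextShiftDeg_le_two_mul hL hd v w x)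
          (nextShiftDeg_nonneg (by linarith) hd v w x) hw.le
    _ = _ := by ring

theorem growthRatio_le {β : ℝ} (hβ : 0 ≤ β) (hL : 0 < L) (hs : 1 ≤ s) (hns : n ≤ s)
    (hd : ∀ x, 0 ≤ d x) (v w x : ℕ) :
    growthRatio β L s n d v w x ≤ (if x = w ∧ n < w then 1 / 2 else 1) *
      exp (-((if x ≤ n then 1 else 0) * ageDrift β s) +
        ((if v = x then invDeg L n d x else 0) + (if w = x then invDeg L n d x else 0))) := by
  have hdx := shiftDeg_pos (n := n) hL hd x
  have hw := ageWeight_pos (β := β) (x := x) hs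
  unfold growthRatio
  rw [div_le_iff₀ (mul_pos hw hdx)]
  by_cases hx : x ≤ n
  · have h1 := ageWeight_succ_le_exp_mul hβ hs (hx.trans hns)
    have hif : ¬ (x = w ∧ n < w) := by omega
    rw [if_neg hif, if_pos hx, one_mul, one_mul, exp_add]
    have hpos : 0 < L + d x := by linarith [hd x]
    have h2 : nextShiftDeg L n d v w x ≤
        exp ((if v = x then invDeg L n d x else 0) + (if w = x then invDeg L n d x else 0)) *
          shiftDeg L n d x := by
      refine le_trans ?_ (mul_le_mul_of_nonneg_right (add_one_le_exp _) hdx.le)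
      unfold nextShiftDeg shiftDeg invDeg
      simp only [if_pos hx]
      apply le_of_eq
      split_ifs <;> field_simp <;> ring
    calc _ ≤ (exp (-(β * (1 / (s : ℝ) - 1 / (s : ℝ) ^ 2))) * ageWeight β s x) *
          (exp ((if v = x then invDeg L n d x else 0) +
            (if w = x then invDeg L n d x else 0)) * shiftDeg L n d x) :=
          mul_le_mul h1 h2 (nextShiftDeg_nonneg hL hd v w x) (mul_pos (exp_pos _) hw).le
      _ = _ := by unfold ageDrift; ring
  · have hinv : invDeg L n d x = 0 := by simp [invDeg, hx]
    simp only [hinv, hx, if_false, ite_self, zero_mul, neg_zero, add_zero, exp_zero, mul_one]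
    have h2 : nextShiftDeg L n d v w x =
        (if x = w ∧ n < w then 1 / 2 else 1) * shiftDeg L n d x := by
      unfold nextShiftDeg shiftDeg
      simp only [if_neg hx]
      by_cases hxw : x = w
      · rw [if_pos hxw, if_pos ⟨hxw, by omega⟩]; ring
      · rw [if_neg hxw, if_neg (by tauto)]; ring
    rw [h2]
    calc _ ≤ ageWeight β s x * ((if x = w ∧ n < w then 1 / 2 else 1) * shiftDeg L n d x) := by
          refine mul_le_mul_of_nonneg_right (ageWeight_succ_le hβ hs) ?_
          refine mul_nonneg ?_ hdx.le
          split_ifs <;> norm_num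
      _ = _ := by ring

theorem invDeg_nonneg (hL : 0 < L) (hd : ∀ x, 0 ≤ d x) (x : ℕ) : 0 ≤ invDeg L n d x := by
  unfold invDeg
  have := hd x
  split_ifs
  · exact div_nonneg zero_le_one (by linarith)
  · exact le_rfl

theorem invDeg_le (hL : 0 < L) (hd : ∀ x, 0 ≤ d x) (x : ℕ) : invDeg L n d x ≤ 1 / L := by
  unfold invDeg
  split_ifs
  · exact one_div_le_one_div_of_le hL (by linarith [hd x])
  · positivity

theorem prod_growthRatio_le {β : ℝ} (hβ : 0 ≤ β) (hL : 0 < L) (hs : 1 ≤ s) (hns : n ≤ s)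
    (hd : ∀ x, 0 ≤ d x) (A : Finset (ℕ × ℕ)) (v w : ℕ) :
    ∏ e ∈ A, (growthRatio β L s n d v w e.1 * growthRatio β L s n d v w e.2) ≤
      (if ∃ e ∈ A, (e.1 = w ∨ e.2 = w) ∧ n < w then 1 / 2 else 1) *
      (exp (-(bornCount n A * ageDrift β s)) * exp (incidence L n d A v) *
        exp (incidence L n d A w)) := by
  have hexp : exp (-(bornCount n A * ageDrift β s)) * exp (incidence L n d A v) *
        exp (incidence L n d A w) = ∏ e ∈ A,
      (exp (-((if e.1 ≤ n then 1 else 0) * ageDrift β s) +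
        ((if v = e.1 then invDeg L n d e.1 else 0) +
          (if w = e.1 then invDeg L n d e.1 else 0))) *
      exp (-((if e.2 ≤ n then 1 else 0) * ageDrift β s) +
        ((if v = e.2 then invDeg L n d e.2 else 0) +
          (if w = e.2 then invDeg L n d e.2 else 0)))) := by
    simp_rw [← exp_add]
    rw [← exp_sum]
    congr 1
    unfold bornCount incidence
    rw [Finset.sum_mul, ← Finset.sum_neg_distrib, ← Finset.sum_add_distrib,
      ← Finset.sum_add_distrib]
    exact Finset.sum_congr rfl fun e _ => by ring
  set h : ℕ × ℕ → ℝ := fun e => if (e.1 = w ∨ e.2 = w) ∧ n < w then 1 / 2 else 1 with hh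
  have hh0 : ∀ e, 0 ≤ h e := fun e => by simp only [hh]; split_ifs <;> norm_num
  have hh1 : ∀ e, h e ≤ 1 := fun e => by simp only [hh]; split_ifs <;> norm_num
  have hprod : ∏ e ∈ A, h e ≤ if ∃ e ∈ A, (e.1 = w ∨ e.2 = w) ∧ n < w then 1 / 2 else 1 := by
    split_ifs with hex
    · obtain ⟨e, he, hew⟩ := hex
      rw [← Finset.mul_prod_erase A h he]
      have h1 : ∏ f ∈ A.erase e, h f ≤ 1 :=
        Finset.prod_le_one (fun f _ => hh0 f) fun f _ => hh1 f
      have h2 : h e = 1 / 2 := by simp only [hh]; rw [if_pos hew]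
      rw [h2]; linarith
    · exact Finset.prod_le_one (fun f _ => hh0 f) fun f _ => hh1 f
  rw [hexp]
  refine le_trans ?_ (mul_le_mul_of_nonneg_right hprod
    (Finset.prod_nonneg fun e _ => (mul_pos (exp_pos _) (exp_pos _)).le))
  rw [← Finset.prod_mul_distrib]
  refine Finset.prod_le_prod (fun e _ => mul_nonneg (growthRatio_nonneg hL hs hd _ _ _)
    (growthRatio_nonneg hL hs hd _ _ _)) fun e _ => ?_
  refine (mul_le_mul (growthRatio_le hβ hL hs hns hd v w e.1)
    (growthRatio_le hβ hL hs hns hd v w e.2) (growthRatio_nonneg hL hs hd _ _ _)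
    (mul_nonneg (by split_ifs <;> norm_num) (exp_pos _).le)).trans ?_
  rw [mul_mul_mul_comm]
  refine mul_le_mul_of_nonneg_right ?_ (mul_pos (exp_pos _) (exp_pos _)).le
  simp only [hh]
  split_ifs <;> first | (exfalso; omega) | norm_num

theorem bornCount_nonneg (A : Finset (ℕ × ℕ)) : 0 ≤ bornCount n A :=
  Finset.sum_nonneg fun e _ => by split_ifs <;> norm_num

theorem bornCount_le {A : Finset (ℕ × ℕ)} (hA : A.card ≤ 3) : bornCount n A ≤ 6 := by
  have h : bornCount n A ≤ ∑ e ∈ A, (2 : ℝ) :=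
    Finset.sum_le_sum fun e _ => by split_ifs <;> norm_num
  have h3 : (A.card : ℝ) ≤ 3 := by exact_mod_cast hA
  simp only [Finset.sum_const, nsmul_eq_mul] at h
  linarith

theorem incidence_nonneg (hL : 0 < L) (hd : ∀ x, 0 ≤ d x) (A : Finset (ℕ × ℕ)) (v : ℕ) :
    0 ≤ incidence L n d A v :=
  Finset.sum_nonneg fun e _ => by
    have h1 := invDeg_nonneg (n := n) hL hd e.1
    have h2 := invDeg_nonneg (n := n) hL hd e.2
    split_ifs <;> linarith

theorem incidence_le (hL : 0 < L) (hd : ∀ x, 0 ≤ d x) {A : Finset (ℕ × ℕ)} (hA : A.card ≤ 3)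
    (hlt : ∀ e ∈ A, e.1 < e.2) (v : ℕ) : incidence L n d A v ≤ 3 / L := by
  have h : incidence L n d A v ≤ ∑ e ∈ A, 1 / L := by
    refine Finset.sum_le_sum fun e he => ?_
    have h1 := invDeg_le (n := n) hL hd e.1
    have h2 := invDeg_le (n := n) hL hd e.2
    have h0 : 0 ≤ 1 / L := by positivity
    have := hlt e he
    split_ifs
    · omega
    · linarith
    · linarith
    · linarith
  have h3 : (A.card : ℝ) ≤ 3 := by exact_mod_cast hA
  have h0 : 0 ≤ 1 / L := by positivity
  simp only [Finset.sum_const, nsmul_eq_mul] at h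
  calc _ ≤ A.card * (1 / L) := h
    _ ≤ 3 * (1 / L) := mul_le_mul_of_nonneg_right h3 h0
    _ = 3 / L := by ring

theorem incidence_eq_zero {v : ℕ} (hv : n < v) (A : Finset (ℕ × ℕ)) :
    incidence L n d A v = 0 := by
  refine Finset.sum_eq_zero fun e _ => ?_
  unfold invDeg
  split_ifs <;> first | omega | simp

theorem sum_mul_exp_incidence_le (hL : 3 ≤ L) (hs : 1 ≤ s) (hd : ∀ x, 0 ≤ d x)
    (hsum : ∑ v ∈ Finset.Icc 1 n, d v = 2 * s) {A : Finset (ℕ × ℕ)} (hA : A.card ≤ 3)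
    (hlt : ∀ e ∈ A, e.1 < e.2) :
    ∑ v ∈ Finset.Icc 1 n, d v / (2 * s) * exp (incidence L n d A v) ≤
      1 + (1 + 3 / L) * (bornCount n A / (2 * s)) := by
  have hs0 : (0 : ℝ) < s := by exact_mod_cast hs
  have hL0 : 0 < L := by linarith
  have hq : ∀ v, 0 ≤ d v / (2 * s) := fun v => div_nonneg (hd v) (by positivity)
  have hexp : ∀ v, exp (incidence L n d A v) ≤ 1 + (1 + 3 / L) * incidence L n d A v := by
    intro v
    have h0 := incidence_nonneg (n := n) hL0 hd A v
    have h1 := incidence_le (n := n) hL0 hd hA hlt v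
    have h3 : 3 / L ≤ 1 := by rw [div_le_one hL0]; exact hL
    have := (abs_le.1 (abs_exp_sub_one_sub_id_le (x := incidence L n d A v)
      (by rw [abs_of_nonneg h0]; linarith))).2
    nlinarith
  have hq1 : ∑ v ∈ Finset.Icc 1 n, d v / (2 * s) = 1 := by
    rw [← Finset.sum_div, hsum, div_self (by positivity)]
  have hsingle : ∀ x, ∑ v ∈ Finset.Icc 1 n,
      d v / (2 * s) * (if v = x then invDeg L n d x else 0) ≤
        (if x ≤ n then (1 : ℝ) else 0) / (2 * s) := by
    intro x
    simp_rw [mul_ite, mul_zero]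
    rw [Finset.sum_ite_eq']
    by_cases hx : x ≤ n
    · rw [if_pos hx]
      have h4 : d x / (2 * s) * invDeg L n d x ≤ 1 / (2 * s) := by
        unfold invDeg
        rw [if_pos hx, div_mul_div_comm, mul_one]
        have := hd x
        rw [div_le_div_iff₀ (by positivity) (by positivity)]
        nlinarith
      split_ifs
      · exact h4
      · positivity
    · rw [if_neg hx, if_neg (by simp; omega)]
      simp
  have hinc : ∑ v ∈ Finset.Icc 1 n, d v / (2 * s) * incidence L n d A v ≤
      bornCount n A / (2 * s) := by
    unfold incidence bornCount
    simp_rw [Finset.mul_sum, mul_add]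
    rw [Finset.sum_comm, Finset.sum_div]
    refine Finset.sum_le_sum fun e _ => ?_
    rw [Finset.sum_add_distrib, add_div]
    exact add_le_add (hsingle e.1) (hsingle e.2)
  calc _ ≤ ∑ v ∈ Finset.Icc 1 n, d v / (2 * s) * (1 + (1 + 3 / L) * incidence L n d A v) :=
        Finset.sum_le_sum fun v _ => mul_le_mul_of_nonneg_left (hexp v) (hq v)
    _ = ∑ v ∈ Finset.Icc 1 n, d v / (2 * s) +
        (1 + 3 / L) * ∑ v ∈ Finset.Icc 1 n, d v / (2 * s) * incidence L n d A v := by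
        rw [Finset.mul_sum, ← Finset.sum_add_distrib]
        exact Finset.sum_congr rfl fun v _ => by ring
    _ ≤ _ := by
        rw [hq1]
        have : 0 ≤ 1 + 3 / L := by positivity
        linarith [mul_le_mul_of_nonneg_left hinc this]


/-- The coefficient of an edge in the potential: `T` times its normalised degrees. -/
noncomputable def edgePotential (β L T : ℝ) (s n : ℕ) (d : ℕ → ℝ) (e : ℕ × ℕ) : ℝ :=
  T * ((ageWeight β s e.1 * shiftDeg L n d e.1) * (ageWeight β s e.2 * shiftDeg L n d e.2))

theorem edgePotential_pos {β : ℝ} (hT : 0 < T) (hL : 0 < L) (hs : 1 ≤ s) (hd : ∀ x, 0 ≤ d x)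
    (e : ℕ × ℕ) : 0 < edgePotential β L T s n d e :=
  mul_pos hT (mul_pos (mul_pos (ageWeight_pos hs) (shiftDeg_pos hL hd _))
    (mul_pos (ageWeight_pos hs) (shiftDeg_pos hL hd _)))

theorem half_rpow_le_ageWeight {β : ℝ} (hβ0 : 0 ≤ β) (hβ : β ≤ 1) {x : ℕ} (hs : 1 ≤ s)
    (hx : x ≤ s + 1) : (s : ℝ) ^ (-β) / 2 ≤ ageWeight β s x := by
  have hs0 : (0 : ℝ) < s := by exact_mod_cast hs
  have h1 : (2 * (s : ℝ)) ^ (-β) ≤ ageWeight β s x := by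
    unfold ageWeight
    apply rpow_le_rpow_of_nonpos
    · exact_mod_cast (by omega : 0 < max s x)
    · exact_mod_cast (by omega : max s x ≤ 2 * s)
    · linarith
  refine le_trans ?_ h1
  rw [mul_rpow (by norm_num) hs0.le, div_eq_inv_mul]
  refine mul_le_mul_of_nonneg_right ?_ (rpow_nonneg hs0.le _)
  rw [rpow_neg (by norm_num)]
  apply inv_anti₀ (rpow_pos_of_pos (by norm_num) _)
  calc (2 : ℝ) ^ β ≤ 2 ^ (1 : ℝ) := rpow_le_rpow_of_exponent_le (by norm_num) hβ
    _ = 2 := by norm_num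

theorem sum_edgeInd_le {β : ℝ} (hT : 0 < T) (hL : 0 < L) (hs : 1 ≤ s) (hns : n ≤ s)
    (hd : ∀ x, 0 ≤ d x) (e : ℕ × ℕ) :
    ∑ o ∈ Finset.Icc 1 n ×ˢ Finset.Icc 1 n, d o.1 / (2 * s) * (d o.2 / (2 * s)) *
      (edgeInd e o.1 o.2 / edgePotential β L T s n d e) ≤
        1 / (2 * (T * ((s : ℝ) * (s : ℝ) ^ (-β)) ^ 2)) := by
  have hs0 : (0 : ℝ) < s := by exact_mod_cast hs
  have hσ : 0 < (s : ℝ) ^ (-β) := rpow_pos_of_pos hs0 _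
  have hq : ∀ v, 0 ≤ d v / (2 * s) := fun v => div_nonneg (hd v) (by positivity)
  have hc := edgePotential_pos (β := β) (n := n) hT hL hs hd e
  set c := edgePotential β L T s n d e with hcdef
  by_cases hmem : e.1 ≤ n ∧ e.2 ≤ n
  · have hle : ∀ o : ℕ × ℕ, edgeInd e o.1 o.2 ≤
        (if o = e then 1 else 0) + (if o = e.swap then 1 else 0) := by
      rintro ⟨a, b⟩
      obtain ⟨x, y⟩ := e
      unfold edgeInd
      simp only [Prod.swap_prod_mk, Prod.mk.injEq]
      split_ifs <;> first | (exfalso; omega) | norm_num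
    have hval : d e.1 / (2 * s) * (d e.2 / (2 * s)) / c ≤
        1 / (4 * (T * ((s : ℝ) * (s : ℝ) ^ (-β)) ^ 2)) := by
      have h1 := hd e.1
      have h2 := hd e.2
      have hcv : c = T * (((s : ℝ) ^ (-β) * (L + d e.1)) * ((s : ℝ) ^ (-β) * (L + d e.2))) := by
        rw [hcdef]
        unfold edgePotential ageWeight shiftDeg
        rw [if_pos hmem.1, if_pos hmem.2, max_eq_left (hmem.1.trans hns),
          max_eq_left (hmem.2.trans hns)]
      rw [div_le_div_iff₀ hc (by positivity), one_mul, hcv]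
      have h3 : d e.1 * d e.2 ≤ (L + d e.1) * (L + d e.2) := by nlinarith
      calc _ = (T * ((s : ℝ) ^ (-β)) ^ 2) * (d e.1 * d e.2) := by field_simp; ring
        _ ≤ (T * ((s : ℝ) ^ (-β)) ^ 2) * ((L + d e.1) * (L + d e.2)) :=
          mul_le_mul_of_nonneg_left h3 (by positivity)
        _ = _ := by ring
    have hnn : 0 ≤ d e.1 / (2 * s) * (d e.2 / (2 * s)) / c :=
      div_nonneg (mul_nonneg (hq _) (hq _)) hc.le
    calc _ ≤ ∑ o ∈ Finset.Icc 1 n ×ˢ Finset.Icc 1 n,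
          ((if o = e then d o.1 / (2 * s) * (d o.2 / (2 * s)) / c else 0) +
            (if o = e.swap then d o.1 / (2 * s) * (d o.2 / (2 * s)) / c else 0)) := by
          refine Finset.sum_le_sum fun o _ => ?_
          calc _ ≤ d o.1 / (2 * s) * (d o.2 / (2 * s)) *
                (((if o = e then 1 else 0) + (if o = e.swap then 1 else 0)) / c) :=
              mul_le_mul_of_nonneg_left (div_le_div_of_nonneg_right (hle o) hc.le)
                (mul_nonneg (hq _) (hq _))
            _ = _ := by split_ifs <;> ring
      _ ≤ d e.1 / (2 * s) * (d e.2 / (2 * s)) / c + d e.1 / (2 * s) * (d e.2 / (2 * s)) / c := by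
          rw [Finset.sum_add_distrib, Finset.sum_ite_eq', Finset.sum_ite_eq']
          refine add_le_add ?_ ?_
          · split_ifs
            · exact le_rfl
            · exact hnn
          · split_ifs
            · rw [Prod.fst_swap, Prod.snd_swap, mul_comm (d e.2 / (2 * (s : ℝ)))]
            · exact hnn
      _ ≤ _ := by
          have : 1 / (2 * (T * ((s : ℝ) * (s : ℝ) ^ (-β)) ^ 2)) =
            1 / (4 * (T * ((s : ℝ) * (s : ℝ) ^ (-β)) ^ 2)) +
            1 / (4 * (T * ((s : ℝ) * (s : ℝ) ^ (-β)) ^ 2)) := by field_simp; norm_num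
          linarith
  · rw [Finset.sum_eq_zero]
    · positivity
    · intro o ho
      have h0 : edgeInd e o.1 o.2 = 0 := by
        unfold edgeInd
        rw [if_neg]
        simp only [Finset.mem_product, Finset.mem_Icc] at ho
        rintro (h | h)
        · rw [← h] at hmem; exact hmem ⟨ho.1.2, ho.2.2⟩
        · have h' : e = (o.1, o.2).swap := by rw [h, Prod.swap_swap]
          rw [h'] at hmem; exact hmem ⟨ho.2.2, ho.1.2⟩
      rw [h0, zero_div, mul_zero]

theorem edgeInd_newVertex_eq_zero {e : ℕ × ℕ} (he : e.2 ≠ n + 1) (he' : e.1 < e.2) {v : ℕ}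
    (hv : v ≤ n) : edgeInd e v (n + 1) = 0 := by
  obtain ⟨x, y⟩ := e
  unfold edgeInd
  rw [if_neg]
  simp only [Prod.swap_prod_mk, Prod.mk.injEq] at *
  omega

theorem sum_edgeInd_newVertex_le {β : ℝ} (hβ0 : 0 ≤ β) (hβ : β ≤ 1) (hT : 0 < T) (hL : 0 < L)
    (hs : 1 ≤ s) (hns : n ≤ s) (hTs : 1 ≤ T * s * ((s : ℝ) ^ (-β)) ^ 2)
    (hd : ∀ x, 0 ≤ d x) (e : ℕ × ℕ) (hlt : e.1 < e.2) :
    ∑ v ∈ Finset.Icc 1 n, d v / (2 * s) *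
      (edgeInd e v (n + 1) / edgePotential β L T s n d e) ≤ 1 / (2 * L) := by
  have hs0 : (0 : ℝ) < s := by exact_mod_cast hs
  have hσ : 0 < (s : ℝ) ^ (-β) := rpow_pos_of_pos hs0 _
  have hc := edgePotential_pos (β := β) (n := n) hT hL hs hd e
  by_cases he : e.2 = n + 1
  · have he1 : e.1 ≤ n := by omega
    have hval : d e.1 / (2 * s) / edgePotential β L T s n d e ≤ 1 / (2 * L) := by
      have h1 := hd e.1
      have hcv : T * (((s : ℝ) ^ (-β) * (L + d e.1)) * ((s : ℝ) ^ (-β) / 2 * (2 * L))) ≤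
          edgePotential β L T s n d e := by
        unfold edgePotential
        have h2 := half_rpow_le_ageWeight hβ0 hβ hs (x := e.2) (by omega)
        have h3 : ageWeight β s e.1 = (s : ℝ) ^ (-β) := by
          unfold ageWeight; rw [max_eq_left (he1.trans hns)]
        have h4 : shiftDeg L n d e.1 = L + d e.1 := by simp [shiftDeg, he1]
        have h5 : 2 * L ≤ shiftDeg L n d e.2 := by
          unfold shiftDeg; rw [if_neg (by omega)]; linarith
        rw [h3, h4]
        refine mul_le_mul_of_nonneg_left (mul_le_mul_of_nonneg_left ?_ (by positivity)) hT.le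
        exact mul_le_mul h2 h5 (by linarith) (ageWeight_pos hs).le
      rw [div_le_div_iff₀ hc (by positivity), one_mul]
      refine le_trans ?_ hcv
      have h6 : d e.1 ≤ (T * s * ((s : ℝ) ^ (-β)) ^ 2) * (L + d e.1) := by nlinarith
      calc _ = L / s * d e.1 := by field_simp
        _ ≤ L / s * ((T * s * ((s : ℝ) ^ (-β)) ^ 2) * (L + d e.1)) :=
          mul_le_mul_of_nonneg_left h6 (by positivity)
        _ = _ := by field_simp
    calc _ ≤ ∑ v ∈ Finset.Icc 1 n,
          (if v = e.1 then d v / (2 * s) / edgePotential β L T s n d e else 0) := by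
          refine Finset.sum_le_sum fun v hv => ?_
          rw [Finset.mem_Icc] at hv
          have h7 : edgeInd e v (n + 1) ≤ if v = e.1 then 1 else 0 := by
            obtain ⟨x, y⟩ := e
            unfold edgeInd
            simp only [Prod.swap_prod_mk, Prod.mk.injEq] at *
            split_ifs <;> first | (exfalso; omega) | norm_num
          calc _ ≤ d v / (2 * s) * ((if v = e.1 then 1 else 0) / edgePotential β L T s n d e) :=
                mul_le_mul_of_nonneg_left (div_le_div_of_nonneg_right h7 hc.le)
                  (div_nonneg (hd v) (by positivity))
            _ = _ := by split_ifs <;> ring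
      _ ≤ _ := by
          rw [Finset.sum_ite_eq']
          split_ifs
          · exact hval
          · positivity
  · rw [Finset.sum_eq_zero]
    · positivity
    · intro v hv
      rw [edgeInd_newVertex_eq_zero he hlt (Finset.mem_Icc.1 hv).2, zero_div, mul_zero]

/-- Relative growth of the factor attached to `e` when the edge `(v, w)` is added. -/
noncomputable def edgeRatio (β L T : ℝ) (s n : ℕ) (d : ℕ → ℝ) (v w : ℕ) (e : ℕ × ℕ) : ℝ :=
  growthRatio β L s n d v w e.1 * growthRatio β L s n d v w e.2 +
    edgeInd e v w / edgePotential β L T s n d e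

theorem prod_edgeRatio_le {β : ℝ} (hβ : 0 ≤ β) (hT : 0 < T) (hL : 2 ≤ L) (hs : 1 ≤ s)
    (hns : n ≤ s) (hd : ∀ x, 0 ≤ d x) {A : Finset (ℕ × ℕ)} (hA : A.card ≤ 3)
    (hlt : ∀ e ∈ A, e.1 < e.2) (v w : ℕ) :
    ∏ e ∈ A, edgeRatio β L T s n d v w e ≤
      (if ∃ e ∈ A, (e.1 = w ∨ e.2 = w) ∧ n < w then 1 / 2 else 1) *
      (exp (-(bornCount n A * ageDrift β s)) * exp (incidence L n d A v) *
        exp (incidence L n d A w)) +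
      16 * ∑ e ∈ A, edgeInd e v w / edgePotential β L T s n d e := by
  have hL0 : 0 < L := by linarith
  have hc : ∀ e, 0 < edgePotential β L T s n d e := edgePotential_pos hT hL0 hs hd
  have hg0 := growthRatio_nonneg (n := n) (β := β) hL0 hs hd v w
  have hg2 := growthRatio_le_two (n := n) hβ hL hs hd v w
  refine (prod_add_le_prod_add_sum A hA _ _ (fun e _ => mul_nonneg (hg0 _) (hg0 _)) ?_
    (fun e _ => div_nonneg (edgeInd_nonneg _ _ _) (hc e).le) ?_).trans
    (add_le_add_left (prod_growthRatio_le hβ hL0 hs hns hd A v w) _)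
  · intro e _
    nlinarith [hg0 e.1, hg0 e.2, hg2 e.1, hg2 e.2]
  · intro e he f hf h1 h2
    exact edgeInd_unique (hlt e he) (hlt f hf) (left_ne_zero_of_mul h1) (left_ne_zero_of_mul h2)

end UnitStep

section ExpectedStep

open Real

variable {p L T : ℝ} {s n : ℕ} {d : ℕ → ℝ}

/-- Logarithmic growth allowed for the potential at step `s`. -/
noncomputable def stepError (β L T : ℝ) (s : ℕ) : ℝ :=
  18 / (s * L) + 42 / (s : ℝ) ^ 2 + 24 / (T * ((s : ℝ) * (s : ℝ) ^ (-β)) ^ 2)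

theorem ageDrift_le {β : ℝ} (hβ0 : 0 ≤ β) (hβ : β ≤ 1) (hs : 1 ≤ s) : ageDrift β s ≤ 1 / 4 := by
  have hs0 : (0 : ℝ) < s := by exact_mod_cast hs
  have h1 : 1 / (s : ℝ) - 1 / (s : ℝ) ^ 2 ≤ 1 / 4 := by
    have : 1 / 4 - (1 / (s : ℝ) - 1 / (s : ℝ) ^ 2) = (1 / 2 - 1 / (s : ℝ)) ^ 2 := by
      field_simp; ring
    nlinarith [sq_nonneg (1 / 2 - 1 / (s : ℝ))]
  have h2 : 0 ≤ 1 / (s : ℝ) - 1 / (s : ℝ) ^ 2 := by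
    have hs1 : (1 : ℝ) ≤ s := by exact_mod_cast hs
    have : 1 / (s : ℝ) - 1 / (s : ℝ) ^ 2 = (s - 1) / (s : ℝ) ^ 2 := by field_simp
    rw [this]
    exact div_nonneg (by linarith) (by positivity)
  unfold ageDrift
  nlinarith

theorem sum_edgeStep_le {β : ℝ} (hβ0 : 0 ≤ β) (hT : 0 < T) (hL : 3 ≤ L) (hs : 1 ≤ s)
    (hns : n ≤ s) (hd : ∀ x, 0 ≤ d x) (hsum : ∑ v ∈ Finset.Icc 1 n, d v = 2 * s)
    {A : Finset (ℕ × ℕ)} (hA : A.card ≤ 3) (hlt : ∀ e ∈ A, e.1 < e.2) :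
    ∑ o ∈ Finset.Icc 1 n ×ˢ Finset.Icc 1 n, d o.1 / (2 * s) * (d o.2 / (2 * s)) *
        ∏ e ∈ A, edgeRatio β L T s n d o.1 o.2 e ≤
      exp (-(bornCount n A * ageDrift β s)) *
        (1 + (1 + 3 / L) * (bornCount n A / (2 * s))) ^ 2 +
      24 / (T * ((s : ℝ) * (s : ℝ) ^ (-β)) ^ 2) := by
  have hs0 : (0 : ℝ) < s := by exact_mod_cast hs
  have hL0 : 0 < L := by linarith
  have hσ : 0 < (s : ℝ) ^ (-β) := rpow_pos_of_pos hs0 _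
  have hq : ∀ v, 0 ≤ d v / (2 * s) := fun v => div_nonneg (hd v) (by positivity)
  set E := exp (-(bornCount n A * ageDrift β s)) with hE
  have hE0 : 0 < E := exp_pos _
  have hY := sum_mul_exp_incidence_le hL hs hd hsum hA hlt
  set Y := ∑ v ∈ Finset.Icc 1 n, d v / (2 * s) * exp (incidence L n d A v) with hYdef
  have hY0 : 0 ≤ Y := Finset.sum_nonneg fun v _ => mul_nonneg (hq v) (exp_pos _).le
  calc _ ≤ ∑ o ∈ Finset.Icc 1 n ×ˢ Finset.Icc 1 n, (E *
        ((d o.1 / (2 * s) * exp (incidence L n d A o.1)) *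
          (d o.2 / (2 * s) * exp (incidence L n d A o.2))) +
        16 * ∑ e ∈ A, d o.1 / (2 * s) * (d o.2 / (2 * s)) *
          (edgeInd e o.1 o.2 / edgePotential β L T s n d e)) := by
        refine Finset.sum_le_sum fun o ho => ?_
        have h := prod_edgeRatio_le hβ0 hT (L := L) (by linarith) hs hns hd hA hlt o.1 o.2
        simp only [Finset.mem_product, Finset.mem_Icc] at ho
        rw [if_neg (by rintro ⟨e, _, _, h⟩; omega)] at h
        refine (mul_le_mul_of_nonneg_left h (mul_nonneg (hq _) (hq _))).trans (le_of_eq ?_)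
        rw [← Finset.mul_sum]
        ring
    _ = E * Y ^ 2 + 16 * ∑ e ∈ A, ∑ o ∈ Finset.Icc 1 n ×ˢ Finset.Icc 1 n,
          d o.1 / (2 * s) * (d o.2 / (2 * s)) *
            (edgeInd e o.1 o.2 / edgePotential β L T s n d e) := by
        rw [Finset.sum_add_distrib, ← Finset.mul_sum, ← Finset.mul_sum, Finset.sum_comm, sq, hYdef,
          Finset.sum_mul_sum, Finset.sum_product]
    _ ≤ E * (1 + (1 + 3 / L) * (bornCount n A / (2 * s))) ^ 2 +
        16 * ∑ e ∈ A, 1 / (2 * (T * ((s : ℝ) * (s : ℝ) ^ (-β)) ^ 2)) := by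
        have h1 := mul_le_mul_of_nonneg_left (pow_le_pow_left₀ hY0 hY 2) hE0.le
        have h2 := Finset.sum_le_sum fun e (_ : e ∈ A) =>
          sum_edgeInd_le (β := β) (n := n) hT hL0 hs hns hd e
        linarith
    _ ≤ _ := by
        have h3 : (A.card : ℝ) ≤ 3 := by exact_mod_cast hA
        have h4 : 0 ≤ 1 / (2 * (T * ((s : ℝ) * (s : ℝ) ^ (-β)) ^ 2)) := by positivity
        have h5 : 24 / (T * ((s : ℝ) * (s : ℝ) ^ (-β)) ^ 2) =
          16 * (3 * (1 / (2 * (T * ((s : ℝ) * (s : ℝ) ^ (-β)) ^ 2)))) := by field_simp; norm_num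
        rw [h5, Finset.sum_const, nsmul_eq_mul]
        linarith [mul_le_mul_of_nonneg_right h3 h4]

theorem sum_vertexStep_le {β : ℝ} (hβ0 : 0 ≤ β) (hβ : β ≤ 1) (hT : 0 < T) (hL : 400 ≤ L)
    (hs : 1 ≤ s) (hns : n ≤ s) (hTs : 1 ≤ T * s * ((s : ℝ) ^ (-β)) ^ 2) (hd : ∀ x, 0 ≤ d x)
    (hsum : ∑ v ∈ Finset.Icc 1 n, d v = 2 * s) {A : Finset (ℕ × ℕ)} (hA : A.card ≤ 3)
    (hlt : ∀ e ∈ A, e.1 < e.2) :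
    ∑ v ∈ Finset.Icc 1 n, d v / (2 * s) * ∏ e ∈ A, edgeRatio β L T s n d v (n + 1) e ≤
      exp (-(bornCount n A * ageDrift β s)) *
        (1 + (1 + 3 / L) * (bornCount n A / (2 * s))) := by
  have hs0 : (0 : ℝ) < s := by exact_mod_cast hs
  have hL0 : 0 < L := by linarith
  have hq : ∀ v, 0 ≤ d v / (2 * s) := fun v => div_nonneg (hd v) (by positivity)
  have hEge : 1 / 8 ≤ exp (-(bornCount n A * ageDrift β s)) := by
    have h1 : bornCount n A * ageDrift β s ≤ 2 := by
      have := ageDrift_le hβ0 hβ hs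
      nlinarith [bornCount_le (n := n) hA, bornCount_nonneg (n := n) A]
    have h2 : exp 2 ≤ 8 := by
      have h3 := exp_one_lt_d9
      have h4 : exp 2 = exp 1 * exp 1 := by rw [← exp_add]; norm_num
      nlinarith [exp_pos 1]
    calc 1 / 8 ≤ 1 / exp 2 := one_div_le_one_div_of_le (exp_pos _) h2
      _ = exp (-2) := by rw [exp_neg, one_div]
      _ ≤ _ := exp_le_exp.2 (by linarith)
  set E := exp (-(bornCount n A * ageDrift β s)) with hE
  have hE0 : 0 < E := exp_pos _
  have hY := sum_mul_exp_incidence_le (L := L) (by linarith) hs hd hsum hA hlt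
  set Y := ∑ v ∈ Finset.Icc 1 n, d v / (2 * s) * exp (incidence L n d A v) with hYdef
  set y := 1 + (1 + 3 / L) * (bornCount n A / (2 * s)) with hy
  have hy1 : 1 ≤ y := by
    have : 0 ≤ (1 + 3 / L) * (bornCount n A / (2 * s)) :=
      mul_nonneg (by positivity) (div_nonneg (bornCount_nonneg A) (by positivity))
    linarith
  set b : ℝ := if ∃ e ∈ A, (e.1 = n + 1 ∨ e.2 = n + 1) ∧ n < n + 1 then 1 / 2 else 1 with hb
  have hb0 : 0 ≤ b := by rw [hb]; split_ifs <;> norm_num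
  have hmain : ∑ v ∈ Finset.Icc 1 n, d v / (2 * s) *
      ∏ e ∈ A, edgeRatio β L T s n d v (n + 1) e ≤ b * (E * Y) +
        16 * ∑ e ∈ A, ∑ v ∈ Finset.Icc 1 n, d v / (2 * s) *
          (edgeInd e v (n + 1) / edgePotential β L T s n d e) := by
    calc _ ≤ ∑ v ∈ Finset.Icc 1 n, ((b * E) *
          (d v / (2 * s) * exp (incidence L n d A v)) + 16 * ∑ e ∈ A, d v / (2 * s) *
            (edgeInd e v (n + 1) / edgePotential β L T s n d e)) := by
          refine Finset.sum_le_sum fun v hv => ?_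
          have h := prod_edgeRatio_le hβ0 hT (L := L) (by linarith) hs hns hd hA hlt v (n + 1)
          rw [incidence_eq_zero (Nat.lt_succ_self n), exp_zero, mul_one] at h
          refine (mul_le_mul_of_nonneg_left h (hq _)).trans (le_of_eq ?_)
          rw [← Finset.mul_sum]
          ring
      _ = _ := by
          rw [Finset.sum_add_distrib, ← Finset.mul_sum, ← Finset.mul_sum, Finset.sum_comm,
            mul_assoc]
  refine hmain.trans ?_
  have hEY : E * Y ≤ E * y := mul_le_mul_of_nonneg_left hY hE0.le
  by_cases hex : ∃ e ∈ A, (e.1 = n + 1 ∨ e.2 = n + 1) ∧ n < n + 1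
  · have hb2 : b = 1 / 2 := if_pos hex
    have h3 : (A.card : ℝ) ≤ 3 := by exact_mod_cast hA
    have h4 : ∑ e ∈ A, ∑ v ∈ Finset.Icc 1 n, d v / (2 * s) *
          (edgeInd e v (n + 1) / edgePotential β L T s n d e) ≤ 1 / 256 := by
      have h5 := Finset.sum_le_sum fun e (he : e ∈ A) =>
        sum_edgeInd_newVertex_le hβ0 hβ hT hL0 hs hns hTs hd e (hlt e he)
      rw [Finset.sum_const, nsmul_eq_mul] at h5
      have h6 : 1 / (2 * L) ≤ 1 / 800 := one_div_le_one_div_of_le (by norm_num) (by linarith)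
      have h7 : 0 ≤ 1 / (2 * L) := by positivity
      nlinarith
    rw [hb2]
    nlinarith
  · have hb1 : b = 1 := if_neg hex
    have h0 : ∑ e ∈ A, ∑ v ∈ Finset.Icc 1 n, d v / (2 * s) *
          (edgeInd e v (n + 1) / edgePotential β L T s n d e) = 0 := by
      refine Finset.sum_eq_zero fun e he => Finset.sum_eq_zero fun v hv => ?_
      rw [edgeInd_newVertex_eq_zero (fun h => hex ⟨e, he, Or.inr h, Nat.lt_succ_self n⟩)
        (hlt e he) (Finset.mem_Icc.1 hv).2, zero_div, mul_zero]
    rw [hb1, h0]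
    linarith

theorem sum_prod_edgeRatio_le (hp0 : 0 < p) (hp1 : p < 1) (hT : 0 < T) (hL : 400 ≤ L)
    (hs : 1 ≤ s) (hns : n ≤ s) (hTs : 1 ≤ T * s * ((s : ℝ) ^ (-(1 - p / 2))) ^ 2)
    (hd : ∀ x, 0 ≤ d x) (hsum : ∑ v ∈ Finset.Icc 1 n, d v = 2 * s) {A : Finset (ℕ × ℕ)}
    (hA : A.card ≤ 3) (hlt : ∀ e ∈ A, e.1 < e.2) :
    ∑ o ∈ Finset.Icc 1 n ×ˢ Finset.Icc 1 n, (1 - p) * (d o.1 / (2 * s) * (d o.2 / (2 * s))) *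
        ∏ e ∈ A, edgeRatio (1 - p / 2) L T s n d o.1 o.2 e +
      ∑ v ∈ Finset.Icc 1 n, p * (d v / (2 * s)) *
        ∏ e ∈ A, edgeRatio (1 - p / 2) L T s n d v (n + 1) e ≤
      exp (stepError (1 - p / 2) L T s) := by
  have hs0 : (0 : ℝ) < s := by exact_mod_cast hs
  have hL0 : 0 < L := by linarith
  have hβ0 : 0 ≤ 1 - p / 2 := by linarith
  have hβ1 : 1 - p / 2 ≤ 1 := by linarith
  have hσ : 0 < (s : ℝ) ^ (-(1 - p / 2)) := rpow_pos_of_pos hs0 _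
  have h1 := sum_edgeStep_le hβ0 hT (L := L) (by linarith) hs hns hd hsum hA hlt
  have h2 := sum_vertexStep_le hβ0 hβ1 hT hL hs hns hTs hd hsum hA hlt
  simp_rw [mul_assoc (1 - p), mul_assoc p, ← Finset.mul_sum]
  unfold stepError
  have hB0 := bornCount_nonneg (n := n) A
  have hB6 := bornCount_le (n := n) hA
  have hζ : 0 ≤ 24 / (T * ((s : ℝ) * (s : ℝ) ^ (-(1 - p / 2))) ^ 2) := by positivity
  set ζ := 24 / (T * ((s : ℝ) * (s : ℝ) ^ (-(1 - p / 2))) ^ 2)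
  set B := bornCount n A
  set κ := ageDrift (1 - p / 2) s with hκ
  set z := (1 + 3 / L) * (B / (2 * s)) with hz
  have hz0 : 0 ≤ z := mul_nonneg (by positivity) (div_nonneg hB0 (by positivity))
  have hE0 := exp_pos (-(B * κ))
  have hzle : z ≤ 6 / s := by
    have h3 : 3 / L ≤ 1 := by rw [div_le_one hL0]; linarith
    have h4 : B / (2 * s) ≤ 3 / s := by
      rw [div_le_div_iff₀ (by positivity) hs0]; nlinarith
    have h5 : 0 ≤ B / (2 * s) := div_nonneg hB0 (by positivity)
    calc z ≤ 2 * (3 / s) := mul_le_mul (by linarith) h4 h5 (by norm_num)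
      _ = 6 / s := by ring
  have hz2 : z ^ 2 ≤ 36 / (s : ℝ) ^ 2 := by
    calc z ^ 2 ≤ (6 / (s : ℝ)) ^ 2 := pow_le_pow_left₀ hz0 hzle 2
      _ = _ := by rw [div_pow]; norm_num
  have hexp : -(B * κ) + (2 * (1 - p / 2) * z + z ^ 2) ≤ 18 / (s * L) + 42 / (s : ℝ) ^ 2 := by
    have h6 : -(B * κ) + 2 * (1 - p / 2) * z =
        ((1 - p / 2) * B) * (1 / (s : ℝ) ^ 2) + ((1 - p / 2) * B) * (3 / (s * L)) := by
      rw [hκ, hz]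
      unfold ageDrift
      field_simp
      ring
    have h7 : (1 - p / 2) * B ≤ 6 := by nlinarith
    have h8 : 0 ≤ 1 / (s : ℝ) ^ 2 := by positivity
    have h9 : 0 ≤ 3 / (s * L) := by positivity
    have h10 := mul_le_mul_of_nonneg_right h7 h8
    have h11 := mul_le_mul_of_nonneg_right h7 h9
    have h12 : 18 / (s * L) + 42 / (s : ℝ) ^ 2 =
      6 * (3 / (s * L)) + 6 * (1 / (s : ℝ) ^ 2) + 36 / (s : ℝ) ^ 2 := by ring
    linarith
  calc _ ≤ (1 - p) * (exp (-(B * κ)) * (1 + z) ^ 2 + ζ) + p * (exp (-(B * κ)) * (1 + z)) :=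
        add_le_add (mul_le_mul_of_nonneg_left h1 (by linarith))
          (mul_le_mul_of_nonneg_left h2 hp0.le)
    _ ≤ exp (-(B * κ)) * (2 * (1 - p / 2) * z + z ^ 2 + 1) + ζ := by
        have : 0 ≤ exp (-(B * κ)) * (p * z ^ 2) := by positivity
        nlinarith
    _ ≤ exp (-(B * κ)) * exp (2 * (1 - p / 2) * z + z ^ 2) + ζ := by
        linarith [mul_le_mul_of_nonneg_left (add_one_le_exp (2 * (1 - p / 2) * z + z ^ 2)) hE0.le]
    _ ≤ exp (18 / (s * L) + 42 / (s : ℝ) ^ 2) + ζ := by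
        rw [← exp_add]
        linarith [exp_le_exp.2 hexp]
    _ ≤ exp (18 / (s * L) + 42 / (s : ℝ) ^ 2) * exp ζ := by
        have h13 : 1 ≤ exp (18 / (s * L) + 42 / (s : ℝ) ^ 2) := one_le_exp (by positivity)
        nlinarith [add_one_le_exp ζ]
    _ = _ := by rw [← exp_add]

/-- The potential of an edge after the edge `(v, w)` has been added. -/
noncomputable def nextEdgePotential (β L T : ℝ) (s n : ℕ) (d : ℕ → ℝ) (v w : ℕ) (e : ℕ × ℕ) : ℝ :=
  T * ((ageWeight β (s + 1) e.1 * nextShiftDeg L n d v w e.1) *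
    (ageWeight β (s + 1) e.2 * nextShiftDeg L n d v w e.2))

theorem add_edgeInd_add_nextEdgePotential_eq {β : ℝ} (hT : 0 < T) (hL : 0 < L) (hs : 1 ≤ s)
    (hd : ∀ x, 0 ≤ d x) (N : ℝ) (v w : ℕ) (e : ℕ × ℕ) :
    N + edgeInd e v w + nextEdgePotential β L T s n d v w e =
      N + edgePotential β L T s n d e * edgeRatio β L T s n d v w e := by
  have h1 := (shiftDeg_pos (n := n) hL hd e.1).ne'
  have h2 := (shiftDeg_pos (n := n) hL hd e.2).ne'
  have h3 := (ageWeight_pos (β := β) (x := e.1) hs).ne'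
  have h4 := (ageWeight_pos (β := β) (x := e.2) hs).ne'
  unfold nextEdgePotential edgeRatio growthRatio edgePotential
  field_simp
  ring

theorem sum_prod_nextEdgePotential_le (hp0 : 0 < p) (hp1 : p < 1) (hT : 0 < T) (hL : 400 ≤ L)
    (hs : 1 ≤ s) (hns : n ≤ s) (hTs : 1 ≤ T * s * ((s : ℝ) ^ (-(1 - p / 2))) ^ 2)
    (hd : ∀ x, 0 ≤ d x) (hsum : ∑ v ∈ Finset.Icc 1 n, d v = 2 * s) {S : Finset (ℕ × ℕ)}
    (hS : S.card ≤ 3) (hlt : ∀ e ∈ S, e.1 < e.2) (N : ℕ × ℕ → ℝ) (hN : ∀ e, 0 ≤ N e) :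
    ∑ o ∈ Finset.Icc 1 n ×ˢ Finset.Icc 1 n, (1 - p) * (d o.1 / (2 * s) * (d o.2 / (2 * s))) *
        ∏ e ∈ S, (N e + edgeInd e o.1 o.2 + nextEdgePotential (1 - p / 2) L T s n d o.1 o.2 e) +
      ∑ v ∈ Finset.Icc 1 n, p * (d v / (2 * s)) *
        ∏ e ∈ S, (N e + edgeInd e v (n + 1) +
          nextEdgePotential (1 - p / 2) L T s n d v (n + 1) e) ≤
      exp (stepError (1 - p / 2) L T s) *
        ∏ e ∈ S, (N e + edgePotential (1 - p / 2) L T s n d e) := by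
  have hL0 : 0 < L := by linarith
  simp_rw [add_edgeInd_add_nextEdgePotential_eq (β := 1 - p / 2) (n := n) hT hL0 hs hd]
  exact sum_mul_prod_add_mul_le _ (fun o : ℕ × ℕ => (1 - p) * (d o.1 / (2 * s) * (d o.2 / (2 * s))))
    _ (fun v => p * (d v / (2 * s))) S N (edgePotential (1 - p / 2) L T s n d)
    (fun o => edgeRatio (1 - p / 2) L T s n d o.1 o.2)
    (fun v => edgeRatio (1 - p / 2) L T s n d v (n + 1)) _ (fun e _ => hN e)
    (fun e _ => (edgePotential_pos hT hL0 hs hd e).le)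
    fun A hA => sum_prod_edgeRatio_le hp0 hp1 hT hL hs hns hTs hd hsum
      ((Finset.card_le_card hA).trans hS) fun e he => hlt e (hA he)

end ExpectedStep

namespace PAProcess

open Real

variable {p : ℝ} (P : PAProcess p) {s t : ℕ} {L T : ℝ} {S : Finset (ℕ × ℕ)} {ω : P.Ω}

theorem nv_le (hs : 1 ≤ s) (ω : P.Ω) : P.nv s ω ≤ s := by
  induction s, hs using Nat.le_induction with
  | base => exact (P.nv_one ω).le
  | succ s hs ih =>
    rw [P.nv_succ s hs ω]
    split_ifs <;> omega

theorem nv_le_nv_succ (hs : 1 ≤ s) (ω : P.Ω) : P.nv s ω ≤ P.nv (s + 1) ω := by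
  rw [P.nv_succ s hs ω]
  exact Nat.le_add_right _ _

theorem nv_mono {r : ℕ} (hr : 1 ≤ r) (hrs : r ≤ s) (ω : P.Ω) : P.nv r ω ≤ P.nv s ω := by
  induction s, hrs using Nat.le_induction with
  | base => exact le_rfl
  | succ s hs ih => exact ih.trans (P.nv_le_nv_succ (hr.trans hs) ω)

theorem ep_mem (hs : 1 ≤ s) (ω : P.Ω) :
    (P.ep s ω).1 ∈ Finset.Icc 1 (P.nv s ω) ∧ (P.ep s ω).2 ∈ Finset.Icc 1 (P.nv s ω) := by
  simp only [Finset.mem_Icc]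
  rcases hs.eq_or_lt with rfl | h
  · simp [P.ep_one ω, P.nv_one ω]
  · obtain ⟨r, rfl⟩ : ∃ r, s = r + 1 := ⟨s - 1, by omega⟩
    have hr : 1 ≤ r := by omega
    have h1 := P.nv_succ r hr ω
    cases hZ : P.Z (r + 1) ω
    · have := P.ep_edgeStep r hr ω hZ
      have := P.nv_le_nv_succ hr ω
      omega
    · have := P.ep_vertexStep r hr ω hZ
      rw [if_pos hZ] at h1
      omega

theorem deg_succ (s x : ℕ) (ω : P.Ω) : P.deg (s + 1) x ω = P.deg s x ω +
    ((if (P.ep (s + 1) ω).1 = x then 1 else 0) + (if (P.ep (s + 1) ω).2 = x then 1 else 0)) := by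
  unfold deg degOf
  rw [Finset.sum_Icc_succ_top (by omega)]

theorem deg_eq_zero_of_lt {x : ℕ} (hx : P.nv s ω < x) : P.deg s x ω = 0 := by
  unfold deg degOf
  refine Finset.sum_eq_zero fun r hr => ?_
  rw [Finset.mem_Icc] at hr
  have h1 := P.ep_mem hr.1 ω
  have h2 := P.nv_mono hr.1 hr.2 ω
  simp only [Finset.mem_Icc] at h1
  rw [if_neg (by omega), if_neg (by omega), add_zero]

theorem deg_le (s x : ℕ) (ω : P.Ω) : P.deg s x ω ≤ 2 * s := by
  have h : P.deg s x ω ≤ ∑ r ∈ Finset.Icc 1 s, 2 := by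
    unfold deg degOf
    exact Finset.sum_le_sum fun r _ => by split_ifs <;> norm_num
  simpa [mul_comm] using h

theorem sum_deg (s : ℕ) (ω : P.Ω) :
    ∑ x ∈ Finset.Icc 1 (P.nv s ω), (P.deg s x ω : ℝ) = 2 * s := by
  have h : ∑ x ∈ Finset.Icc 1 (P.nv s ω), P.deg s x ω = 2 * s := by
    unfold deg degOf
    rw [Finset.sum_comm]
    have h2 : ∀ r ∈ Finset.Icc 1 s, ∑ x ∈ Finset.Icc 1 (P.nv s ω),
        ((if (P.ep r ω).1 = x then 1 else 0) + (if (P.ep r ω).2 = x then 1 else 0)) = 2 := by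
      intro r hr
      rw [Finset.mem_Icc] at hr
      have h1 := P.ep_mem hr.1 ω
      have h2 := P.nv_mono hr.1 hr.2 ω
      simp only [Finset.mem_Icc] at h1
      rw [Finset.sum_add_distrib, Finset.sum_ite_eq, Finset.sum_ite_eq,
        if_pos (Finset.mem_Icc.2 (by omega)), if_pos (Finset.mem_Icc.2 (by omega))]
    rw [Finset.sum_congr rfl h2]
    simp [mul_comm]
  exact_mod_cast h

/-- Number of parallel edges joining the two vertices of `e` at time `s`. -/
noncomputable def edgeCount (s : ℕ) (e : ℕ × ℕ) (ω : P.Ω) : ℝ :=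
  ∑ r ∈ Finset.Icc 1 s, edgeInd e (P.ep r ω).1 (P.ep r ω).2

/-- Product over the edges of `S` of the edge multiplicities corrected by a multiple of the
normalised degrees of the endpoints. -/
noncomputable def potential (L T : ℝ) (S : Finset (ℕ × ℕ)) (s : ℕ) (ω : P.Ω) : ℝ :=
  ∏ e ∈ S, (P.edgeCount s e ω +
    edgePotential (1 - p / 2) L T s (P.nv s ω) (fun x => P.deg s x ω) e)

/-- The potential at time `s + 1` if the edge `(v, w)` is added. -/
noncomputable def nextPotential (L T : ℝ) (S : Finset (ℕ × ℕ)) (s v w : ℕ) (ω : P.Ω) : ℝ :=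
  ∏ e ∈ S, (P.edgeCount s e ω + edgeInd e v w +
    nextEdgePotential (1 - p / 2) L T s (P.nv s ω) (fun x => P.deg s x ω) v w e)

theorem edgeCount_nonneg (s : ℕ) (e : ℕ × ℕ) (ω : P.Ω) : 0 ≤ P.edgeCount s e ω :=
  Finset.sum_nonneg fun _ _ => edgeInd_nonneg _ _ _

theorem edgeCount_le (s : ℕ) (e : ℕ × ℕ) (ω : P.Ω) : P.edgeCount s e ω ≤ s := by
  have h : P.edgeCount s e ω ≤ ∑ r ∈ Finset.Icc 1 s, (1 : ℝ) :=
    Finset.sum_le_sum fun _ _ => edgeInd_le_one _ _ _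
  simpa using h

theorem shiftDeg_succ (hs : 1 ≤ s) (x : ℕ) (ω : P.Ω) :
    shiftDeg L (P.nv (s + 1) ω) (fun x => P.deg (s + 1) x ω) x =
      nextShiftDeg L (P.nv s ω) (fun x => P.deg s x ω) (P.ep (s + 1) ω).1
        (P.ep (s + 1) ω).2 x := by
  unfold shiftDeg nextShiftDeg
  beta_reduce
  have h1 := P.nv_succ s hs ω
  have h2 := P.deg_succ s x ω
  have h3 := P.deg_eq_zero_of_lt (s := s) (ω := ω) (x := x)
  cases hZ : P.Z (s + 1) ω
  · have h4 := P.ep_edgeStep s hs ω hZ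
    rw [hZ] at h1
    simp only [Bool.false_eq_true, if_false, add_zero] at h1
    rw [h1, h2]
    by_cases hx : x ≤ P.nv s ω
    · simp only [if_pos hx]
      push_cast
      ring
    · simp only [if_neg hx]
      rw [if_neg (by omega)]
  · have h4 := P.ep_vertexStep s hs ω hZ
    rw [hZ, if_pos rfl] at h1
    rw [h1, h2]
    by_cases hx : x ≤ P.nv s ω
    · rw [if_pos (by omega), if_pos hx]
      push_cast
      ring
    · rw [h3 (by omega), if_neg hx, h4.1]
      by_cases hx' : x = P.nv s ω + 1
      · rw [if_pos (by omega), if_pos hx', if_neg (by omega), if_pos hx'.symm]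
        norm_num
      · rw [if_neg (by omega), if_neg hx']

theorem potential_succ (hs : 1 ≤ s) (ω : P.Ω) : P.potential L T S (s + 1) ω =
    P.nextPotential L T S s (P.ep (s + 1) ω).1 (P.ep (s + 1) ω).2 ω := by
  unfold potential nextPotential
  refine Finset.prod_congr rfl fun e _ => ?_
  unfold edgePotential nextEdgePotential edgeCount
  rw [P.shiftDeg_succ hs, P.shiftDeg_succ hs, Finset.sum_Icc_succ_top (by omega)]

theorem potential_one (hS : ∀ e ∈ S, e.1 < e.2) (ω : P.Ω) : P.potential L T S 1 ω =
    ∏ e ∈ S, edgePotential (1 - p / 2) L T 1 1 (fun x => if x = 1 then 2 else 0) e := by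
  unfold potential
  refine Finset.prod_congr rfl fun e he => ?_
  have h1 : P.edgeCount 1 e ω = 0 := by
    have := hS e he
    obtain ⟨x, y⟩ := e
    unfold edgeCount edgeInd
    simp only [Finset.Icc_self, Finset.sum_singleton, P.ep_one ω, Prod.swap_prod_mk,
      Prod.mk.injEq] at *
    rw [if_neg (by omega)]
  have h2 : (fun x => (P.deg 1 x ω : ℝ)) = fun x => if x = 1 then 2 else 0 := by
    funext x
    unfold deg degOf
    simp only [Finset.Icc_self, Finset.sum_singleton, P.ep_one ω, eq_comm (a := x)]
    split_ifs <;> norm_num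
  rw [h1, zero_add, P.nv_one ω, h2]

theorem one_le_edgeCount_of_joined {i j : ℕ} (h : P.Joined t i j ω) :
    1 ≤ P.edgeCount t (i, j) ω := by
  obtain ⟨r, hr, h⟩ := h
  have h1 : edgeInd (i, j) (P.ep r ω).1 (P.ep r ω).2 = 1 := if_pos h
  rw [← h1]
  exact Finset.single_le_sum (f := fun r => edgeInd (i, j) (P.ep r ω).1 (P.ep r ω).2)
    (fun _ _ => edgeInd_nonneg _ _ _) hr

theorem edgePotential_deg_pos (hT : 0 < T) (hL : 0 < L) (hs : 1 ≤ s) (e : ℕ × ℕ) (ω : P.Ω) :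
    0 < edgePotential (1 - p / 2) L T s (P.nv s ω) (fun x => P.deg s x ω) e :=
  edgePotential_pos hT hL hs (fun _ => Nat.cast_nonneg _) e

theorem potential_nonneg (hT : 0 < T) (hL : 0 < L) (hs : 1 ≤ s) (ω : P.Ω) :
    0 ≤ P.potential L T S s ω :=
  Finset.prod_nonneg fun e _ =>
    add_nonneg (P.edgeCount_nonneg s e ω) (P.edgePotential_deg_pos hT hL hs e ω).le

theorem one_le_potential_of_joined (hT : 0 < T) (hL : 0 < L) (ht : 1 ≤ t)
    (h : ∀ e ∈ S, P.Joined t e.1 e.2 ω) : 1 ≤ P.potential L T S t ω := by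
  have h1 : ∏ e ∈ S, (1 : ℝ) ≤ P.potential L T S t ω :=
    Finset.prod_le_prod (fun _ _ => zero_le_one) fun e he => by
      have h2 := P.one_le_edgeCount_of_joined (h e he)
      have h3 := P.edgePotential_deg_pos hT hL ht e ω
      simp only [Prod.mk.eta] at h2
      linarith
  simpa using h1

end PAProcess

section Expectation

open Real

theorem integral_indicator_mul_of_condExp {Ω : Type*} {m m0 : MeasurableSpace Ω}
    {μ : Measure Ω} [IsFiniteMeasure μ] (hm : m ≤ m0) {A : Set Ω} (hA : MeasurableSet[m0] A)
    {q F : Ω → ℝ} (hq : μ[A.indicator (fun _ => (1 : ℝ)) | m] =ᵐ[μ] q)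
    (hF : Measurable[m] F) {K : ℝ} (hK : ∀ ω, |F ω| ≤ K) :
    Integrable (fun ω => A.indicator (fun _ => (1 : ℝ)) ω * F ω) μ ∧
      Integrable (fun ω => q ω * F ω) μ ∧
      ∫ ω, A.indicator (fun _ => (1 : ℝ)) ω * F ω ∂μ = ∫ ω, q ω * F ω ∂μ := by
  have hI : Integrable (A.indicator (fun _ => (1 : ℝ))) μ := (integrable_const 1).indicator hA
  have hFs : StronglyMeasurable[m] F := hF.stronglyMeasurable
  have h1 := condExp_stronglyMeasurable_mul_of_bound hm hFs hI K
    (ae_of_all _ fun ω => by rw [Real.norm_eq_abs]; exact hK ω)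
  have h2 : μ[F * A.indicator (fun _ => (1 : ℝ)) | m] =ᵐ[μ] fun ω => q ω * F ω := by
    filter_upwards [h1, hq] with ω h1 h2
    rw [h1, Pi.mul_apply, h2, mul_comm]
  refine ⟨?_, integrable_condExp.congr h2, ?_⟩
  · exact hI.mul_bdd (hF.mono hm le_rfl).aestronglyMeasurable
      (ae_of_all _ fun ω => by rw [Real.norm_eq_abs]; exact hK ω)
  · rw [← integral_congr_ae h2, integral_condExp hm]
    exact integral_congr_ae (ae_of_all _ fun ω => mul_comm _ _)

theorem measurable_apply_nat {Ω : Type*} {m : MeasurableSpace Ω} {n : Ω → ℕ} (hn : Measurable n)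
    {F : ℕ → Ω → ℝ} (hF : ∀ k, Measurable (F k)) : Measurable fun ω => F (n ω) ω :=
  (measurable_from_prod_countable_right (f := fun q : ℕ × Ω => F q.1 q.2) hF).comp
    (hn.prodMk measurable_id)

end Expectation

namespace PAProcess

section Measure

open Real

attribute [local instance] PAProcess.m0 PAProcess.isProb

variable {p : ℝ} (P : PAProcess p) {s t : ℕ} {L T : ℝ} {S : Finset (ℕ × ℕ)} {ω : P.Ω}

theorem measurable_comp_ep {r : ℕ} (hr : r ≤ s) (f : ℕ × ℕ → ℝ) :
    Measurable[P.ℱ s] fun ω => f (P.ep r ω) :=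
  (Measurable.of_discrete (f := f)).comp ((P.ep_meas r).mono (P.ℱ.mono hr) le_rfl)

theorem measurable_edgeCount (s : ℕ) (e : ℕ × ℕ) : Measurable[P.ℱ s] (P.edgeCount s e) :=
  Finset.measurable_fun_sum _ fun _ hr =>
    P.measurable_comp_ep (Finset.mem_Icc.1 hr).2 fun o => edgeInd e o.1 o.2

theorem measurable_deg (s x : ℕ) : Measurable[P.ℱ s] fun ω => (P.deg s x ω : ℝ) := by
  unfold deg degOf
  push_cast
  exact Finset.measurable_fun_sum _ fun _ hr => P.measurable_comp_ep (Finset.mem_Icc.1 hr).2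
    fun o => (if o.1 = x then 1 else 0) + (if o.2 = x then 1 else 0)

theorem measurable_nextShiftDeg (s v w x : ℕ) : Measurable[P.ℱ s] fun ω =>
    nextShiftDeg L (P.nv s ω) (fun x => P.deg s x ω) v w x := by
  unfold nextShiftDeg
  refine Measurable.ite ?_ ?_ measurable_const
  · exact P.nv_meas s (MeasurableSet.of_discrete (s := {n | x ≤ n}))
  · exact (((P.measurable_deg s x).const_add L).add_const _).add_const _

theorem measurable_nextPotential (s v w : ℕ) :
    Measurable[P.ℱ s] (P.nextPotential L T S s v w) := by
  unfold nextPotential nextEdgePotential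
  refine Finset.measurable_fun_prod _ fun e _ => ?_
  exact ((P.measurable_edgeCount s e).add_const _).add
    ((((P.measurable_nextShiftDeg s v w e.1).const_mul _).mul
      ((P.measurable_nextShiftDeg s v w e.2).const_mul _)).const_mul _)

theorem measurable_nextPotential_nv (s v : ℕ) :
    Measurable[P.ℱ s] fun ω => P.nextPotential L T S s v (P.nv s ω + 1) ω :=
  measurable_apply_nat (P.nv_meas s) fun n => P.measurable_nextPotential s v (n + 1)

theorem nextPotential_nonneg (hT : 0 < T) (hL : 0 < L) (hs : 1 ≤ s) (v w : ℕ) (ω : P.Ω) :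
    0 ≤ P.nextPotential L T S s v w ω := by
  have h : ∀ x, 0 ≤ ageWeight (1 - p / 2) (s + 1) x *
      nextShiftDeg L (P.nv s ω) (fun x => (P.deg s x ω : ℝ)) v w x := fun x =>
    mul_nonneg (ageWeight_pos (by omega)).le
      (nextShiftDeg_nonneg hL (fun _ => Nat.cast_nonneg _) v w x)
  exact Finset.prod_nonneg fun e _ => add_nonneg
    (add_nonneg (P.edgeCount_nonneg s e ω) (edgeInd_nonneg _ _ _))
    (mul_nonneg hT.le (mul_nonneg (h _) (h _)))

theorem nextPotential_le (hT : 0 < T) (hL : 0 < L) (hs : 1 ≤ s) (v w : ℕ) (ω : P.Ω) :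
    P.nextPotential L T S s v w ω ≤ ∏ e ∈ S, (s + 1 +
      T * ((ageWeight (1 - p / 2) (s + 1) e.1 * (2 * L + 2 * s + 2)) *
        (ageWeight (1 - p / 2) (s + 1) e.2 * (2 * L + 2 * s + 2)))) := by
  have hw : ∀ x, 0 < ageWeight (1 - p / 2) (s + 1) x := fun x => ageWeight_pos (by omega)
  have h0 : ∀ x, 0 ≤ nextShiftDeg L (P.nv s ω) (fun x => (P.deg s x ω : ℝ)) v w x :=
    nextShiftDeg_nonneg hL (fun _ => Nat.cast_nonneg _) v w
  have h1 : ∀ x, nextShiftDeg L (P.nv s ω) (fun x => (P.deg s x ω : ℝ)) v w x ≤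
      2 * L + 2 * s + 2 := by
    intro x
    have h2 : (P.deg s x ω : ℝ) ≤ 2 * s := by exact_mod_cast P.deg_le s x ω
    have h3 : (0 : ℝ) ≤ s := Nat.cast_nonneg _
    unfold nextShiftDeg
    split_ifs <;> linarith
  have h2 : ∀ x, 0 ≤ ageWeight (1 - p / 2) (s + 1) x *
      nextShiftDeg L (P.nv s ω) (fun x => (P.deg s x ω : ℝ)) v w x := fun x =>
    mul_nonneg (hw x).le (h0 x)
  refine Finset.prod_le_prod (fun e _ => add_nonneg
    (add_nonneg (P.edgeCount_nonneg s e ω) (edgeInd_nonneg _ _ _))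
    (mul_nonneg hT.le (mul_nonneg (h2 _) (h2 _)))) fun e _ => ?_
  refine add_le_add (add_le_add (P.edgeCount_le s e ω) (edgeInd_le_one _ _ _)) ?_
  refine mul_le_mul_of_nonneg_left (mul_le_mul ?_ ?_ (h2 _) ?_) hT.le
  · exact mul_le_mul_of_nonneg_left (h1 _) (hw _).le
  · exact mul_le_mul_of_nonneg_left (h1 _) (hw _).le
  · exact mul_nonneg (hw _).le (by positivity)

theorem potential_succ_eq_sum (hs : 1 ≤ s) (ω : P.Ω) : P.potential L T S (s + 1) ω =
    ∑ o ∈ Finset.Icc 1 s ×ˢ Finset.Icc 1 s,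
      {ω | P.Z (s + 1) ω = false ∧ P.ep (s + 1) ω = (o.1, o.2)}.indicator (fun _ => (1 : ℝ)) ω *
        P.nextPotential L T S s o.1 o.2 ω +
    ∑ v ∈ Finset.Icc 1 s,
      {ω | P.Z (s + 1) ω = true ∧ P.ep (s + 1) ω = (v, P.nv s ω + 1)}.indicator
        (fun _ => (1 : ℝ)) ω * P.nextPotential L T S s v (P.nv s ω + 1) ω := by
  have hn := P.nv_le hs ω
  simp only [Set.indicator_apply, Set.mem_ofPred_eq, ite_mul, one_mul, zero_mul]
  rw [P.potential_succ hs]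
  cases hZ : P.Z (s + 1) ω
  · have h := P.ep_edgeStep s hs ω hZ
    simp only [true_and, Bool.false_eq_true, false_and, if_false, Finset.sum_const_zero, add_zero,
      Prod.mk.eta]
    rw [Finset.sum_ite_eq, if_pos]
    simp only [Finset.mem_product, Finset.mem_Icc]
    omega
  · have h := P.ep_vertexStep s hs ω hZ
    simp only [true_and, Bool.true_eq_false, false_and, if_false, Finset.sum_const_zero, zero_add]
    rw [Finset.sum_eq_single_of_mem (P.ep (s + 1) ω).1 (Finset.mem_Icc.2 (by omega)),
      if_pos (by rw [← h.1]), h.1]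
    intro v _ hv
    rw [if_neg]
    intro h'
    exact hv (by rw [h'])

theorem integral_potential_succ_le (hp0 : 0 < p) (hp1 : p < 1) (hT : 0 < T) (hL : 400 ≤ L)
    (hs : 1 ≤ s) (hTs : 1 ≤ T * s * ((s : ℝ) ^ (-(1 - p / 2))) ^ 2) (hS : S.card ≤ 3)
    (hlt : ∀ e ∈ S, e.1 < e.2) (hpotInt : Integrable (P.potential L T S s) P.μ) :
    Integrable (P.potential L T S (s + 1)) P.μ ∧
      ∫ ω, P.potential L T S (s + 1) ω ∂P.μ ≤
        exp (stepError (1 - p / 2) L T s) * ∫ ω, P.potential L T S s ω ∂P.μ := by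
  have hL0 : 0 < L := by linarith
  have hs0 : (0 : ℝ) < s := by exact_mod_cast hs
  have habs : ∀ v w ω, |P.nextPotential L T S s v w ω| ≤ ∏ e ∈ S, (s + 1 +
      T * ((ageWeight (1 - p / 2) (s + 1) e.1 * (2 * L + 2 * s + 2)) *
        (ageWeight (1 - p / 2) (s + 1) e.2 * (2 * L + 2 * s + 2)))) := fun v w ω => by
    rw [abs_of_nonneg (P.nextPotential_nonneg hT hL0 hs v w ω)]
    exact P.nextPotential_le hT hL0 hs v w ω
  have hZm : ∀ b, MeasurableSet {ω | P.Z (s + 1) ω = b} := fun b =>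
    ((P.Z_meas (s + 1)).mono (P.ℱ.le _) le_rfl) (MeasurableSet.of_discrete (s := {b}))
  have hepm : Measurable (P.ep (s + 1)) := (P.ep_meas (s + 1)).mono (P.ℱ.le _) le_rfl
  have hnvm : Measurable (P.nv s) := (P.nv_meas s).mono (P.ℱ.le _) le_rfl
  have hE := fun o : ℕ × ℕ => integral_indicator_mul_of_condExp (P.ℱ.le s)
    ((hZm false).inter (hepm (MeasurableSet.of_discrete (s := {(o.1, o.2)}))))
    (P.condLaw_edge s hs o.1 o.2) (P.measurable_nextPotential s o.1 o.2) (habs o.1 o.2)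
  have hV := fun v : ℕ => integral_indicator_mul_of_condExp (P.ℱ.le s)
    ((hZm true).inter (measurableSet_eq_fun hepm
      ((measurable_const (a := v)).prodMk (hnvm.add_const 1))))
    (P.condLaw_vertex s hs v) (P.measurable_nextPotential_nv s v) (fun ω => habs v _ ω)
  have heq : P.potential L T S (s + 1) = _ := funext fun ω => P.potential_succ_eq_sum hs ω
  have hI1 := integrable_finsetSum (Finset.Icc 1 s ×ˢ Finset.Icc 1 s) fun o _ => (hE o).1
  have hI2 := integrable_finsetSum (Finset.Icc 1 s) fun v _ => (hV v).1
  have hJ1 := integrable_finsetSum (Finset.Icc 1 s ×ˢ Finset.Icc 1 s) fun o _ => (hE o).2.1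
  have hJ2 := integrable_finsetSum (Finset.Icc 1 s) fun v _ => (hV v).2.1
  refine ⟨by rw [heq]; exact hI1.add hI2, ?_⟩
  calc _ = ∫ ω, (∑ o ∈ Finset.Icc 1 s ×ˢ Finset.Icc 1 s,
        (1 - p) * (degOf P.ep s o.1 ω : ℝ) * (degOf P.ep s o.2 ω : ℝ) / (2 * s) ^ 2 *
          P.nextPotential L T S s o.1 o.2 ω +
        ∑ v ∈ Finset.Icc 1 s, p * (degOf P.ep s v ω : ℝ) / (2 * s) *
          P.nextPotential L T S s v (P.nv s ω + 1) ω) ∂P.μ := by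
        rw [integral_add hJ1 hJ2, integral_finsetSum _ fun o _ => (hE o).2.1,
          integral_finsetSum _ fun v _ => (hV v).2.1,
          ← Finset.sum_congr rfl fun o _ => (hE o).2.2,
          ← Finset.sum_congr rfl fun v _ => (hV v).2.2,
          ← integral_finsetSum _ fun o _ => (hE o).1,
          ← integral_finsetSum _ fun v _ => (hV v).1, ← integral_add hI1 hI2, heq]
        rfl
    _ ≤ ∫ ω, exp (stepError (1 - p / 2) L T s) * P.potential L T S s ω ∂P.μ := by
        refine integral_mono (hJ1.add hJ2) (hpotInt.const_mul _) fun ω => ?_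
        have hn := P.nv_le hs ω
        have h := sum_prod_nextEdgePotential_le hp0 hp1 hT hL hs hn hTs
          (d := fun x => (P.deg s x ω : ℝ)) (fun _ => Nat.cast_nonneg _) (P.sum_deg s ω) hS hlt
          (fun e => P.edgeCount s e ω) fun e => P.edgeCount_nonneg s e ω
        refine le_trans (le_of_eq ?_) h
        have hsub : Finset.Icc 1 (P.nv s ω) ⊆ Finset.Icc 1 s := Finset.Icc_subset_Icc le_rfl hn
        congr 1
        · rw [← Finset.sum_subset (Finset.product_subset_product hsub hsub)]
          · refine Finset.sum_congr rfl fun o _ => ?_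
            unfold nextPotential deg
            field_simp
          · intro o ho ho'
            simp only [Finset.mem_product, Finset.mem_Icc] at ho ho'
            by_cases h1 : o.1 ≤ P.nv s ω
            · have h2 : degOf P.ep s o.2 ω = 0 := P.deg_eq_zero_of_lt (by omega)
              simp [h2]
            · have h2 : degOf P.ep s o.1 ω = 0 := P.deg_eq_zero_of_lt (by omega)
              simp [h2]
        · rw [← Finset.sum_subset hsub]
          · refine Finset.sum_congr rfl fun v _ => ?_
            unfold nextPotential deg
            rw [mul_div_assoc]
          · intro v hv hv'
            simp only [Finset.mem_Icc] at hv hv'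
            have h2 : degOf P.ep s v ω = 0 := P.deg_eq_zero_of_lt (by omega)
            simp [h2]
    _ = _ := integral_const_mul _ _

theorem integral_potential_le (hp0 : 0 < p) (hp1 : p < 1) (hT : 0 < T) (hL : 400 ≤ L)
    (ht : 1 ≤ t) (hTs : ∀ s : ℕ, 1 ≤ s → s ≤ t → 1 ≤ T * s * ((s : ℝ) ^ (-(1 - p / 2))) ^ 2)
    (hS : S.card ≤ 3) (hlt : ∀ e ∈ S, e.1 < e.2) :
    Integrable (P.potential L T S t) P.μ ∧
      ∫ ω, P.potential L T S t ω ∂P.μ ≤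
        exp (∑ s ∈ Finset.Ico 1 t, stepError (1 - p / 2) L T s) *
          ∏ e ∈ S, edgePotential (1 - p / 2) L T 1 1 (fun x => if x = 1 then 2 else 0) e := by
  induction t, ht using Nat.le_induction with
  | base =>
    have h : P.potential L T S 1 = fun _ => _ := funext fun ω => P.potential_one hlt ω
    rw [h]
    refine ⟨integrable_const _, ?_⟩
    simp
  | succ s hs ih =>
    obtain ⟨h1, h2⟩ := ih fun r hr hrs => hTs r hr (by omega)
    obtain ⟨h3, h4⟩ := P.integral_potential_succ_le hp0 hp1 hT hL hs (hTs s hs (by omega)) hS hlt h1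
    refine ⟨h3, h4.trans ?_⟩
    rw [Finset.sum_Ico_succ_top hs, add_comm, exp_add, mul_assoc]
    exact mul_le_mul_of_nonneg_left h2 (exp_pos _).le

end Measure

end PAProcess

section Truncation

open Real

variable {p : ℝ} {t : ℕ}

/-- Upper bound, up to powers of `log t`, for the expected number of edges joining the vertices
`e.1` and `e.2` at time `t`. -/
noncomputable def edgeScale (p : ℝ) (t : ℕ) (e : ℕ × ℕ) : ℝ :=
  (t : ℝ) ^ (1 - p) * ((e.1 : ℝ) ^ (-(1 - p / 2)) * (e.2 : ℝ) ^ (-(1 - p / 2)))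

/-- The index scale `t ^ α`: two vertices are typically joined when the product of their indices
is at most `threshold p t ^ 2`. -/
noncomputable def threshold (p : ℝ) (t : ℕ) : ℝ := (t : ℝ) ^ ((1 - p) / (2 - p))

theorem threshold_pos (ht : 1 ≤ t) : 0 < threshold p t :=
  rpow_pos_of_pos (by exact_mod_cast ht) _

theorem edgeScale_eq (hp1 : p < 1) (ht : 1 ≤ t) {x y : ℕ} (hx : 1 ≤ x) (hy : 1 ≤ y) :
    edgeScale p t (x, y) =
      (threshold p t / x) ^ (1 - p / 2) * (threshold p t / y) ^ (1 - p / 2) := by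
  have hx0 : (0 : ℝ) < x := by exact_mod_cast hx
  have hy0 : (0 : ℝ) < y := by exact_mod_cast hy
  have ht0 : (0 : ℝ) < t := by exact_mod_cast ht
  have hθ := threshold_pos (p := p) ht
  have h1 : threshold p t ^ (1 - p / 2) * threshold p t ^ (1 - p / 2) = (t : ℝ) ^ (1 - p) := by
    have h2 : 2 - p ≠ 0 := by linarith
    unfold threshold
    rw [← rpow_mul ht0.le, ← rpow_add ht0]
    congr 1
    field_simp
    ring
  unfold edgeScale
  rw [div_rpow hθ.le hx0.le, div_rpow hθ.le hy0.le, rpow_neg hx0.le, rpow_neg hy0.le, ← h1]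
  have := (rpow_pos_of_pos hx0 (1 - p / 2)).ne'
  have := (rpow_pos_of_pos hy0 (1 - p / 2)).ne'
  field_simp

theorem edgeScale_pos (ht : 1 ≤ t) {e : ℕ × ℕ} (hx : 1 ≤ e.1) (hy : 1 ≤ e.2) :
    0 < edgeScale p t e := by
  have hx0 : (0 : ℝ) < e.1 := by exact_mod_cast hx
  have hy0 : (0 : ℝ) < e.2 := by exact_mod_cast hy
  have ht0 : (0 : ℝ) < t := by exact_mod_cast ht
  unfold edgeScale
  positivity

theorem ite_lt_one_le_rpow {y l : ℝ} (hy : 0 < y) (hl0 : 0 ≤ l) (hl1 : l ≤ 1) :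
    (if y < 1 then y else 1) ≤ y ^ l := by
  split_ifs with h
  · simpa using rpow_le_rpow_of_exponent_ge hy h.le hl1
  · exact one_le_rpow (not_lt.1 h) hl0

theorem ite_edgeScale_le (hp1 : p < 1) (ht : 1 ≤ t) {x y : ℕ} (hx : 1 ≤ x) (hy : 1 ≤ y)
    {K l : ℝ} (hK : 1 ≤ K) (hl0 : 0 ≤ l) (hl1 : l ≤ 1) :
    (if K * edgeScale p t (x, y) < 1 then K * edgeScale p t (x, y) else 1) ≤
      K * ((threshold p t / x) ^ ((1 - p / 2) * l) * (threshold p t / y) ^ ((1 - p / 2) * l)) := by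
  have hx0 : (0 : ℝ) < x := by exact_mod_cast hx
  have hy0 : (0 : ℝ) < y := by exact_mod_cast hy
  have hθ := threshold_pos (p := p) ht
  have hX : 0 < edgeScale p t (x, y) := edgeScale_pos ht hx hy
  refine (ite_lt_one_le_rpow (mul_pos (by linarith) hX) hl0 hl1).trans ?_
  have h : (threshold p t / x) ^ ((1 - p / 2) * l) * (threshold p t / y) ^ ((1 - p / 2) * l) =
      edgeScale p t (x, y) ^ l := by
    rw [edgeScale_eq hp1 ht hx hy, mul_rpow (by positivity) (by positivity),
      rpow_mul (div_pos hθ hx0).le, rpow_mul (div_pos hθ hy0).le]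
  rw [h, mul_rpow (by linarith) hX.le]
  refine mul_le_mul_of_nonneg_right ?_ (rpow_nonneg hX.le _)
  simpa using rpow_le_rpow_of_exponent_le hK hl1

/-- Contribution of the oldest vertex of a triangle. -/
noncomputable def oldestWeight (p : ℝ) (t i : ℕ) : ℝ :=
  min ((threshold p t / i) ^ p) ((threshold p t / i) ^ (2 - p))

theorem prod_ite_edgeScale_le (hp0 : 0 < p) (hp1 : p < 1) (ht : 1 ≤ t) {i j k : ℕ} (hi : 1 ≤ i)
    (hj : 1 ≤ j) (hk : 1 ≤ k) {K : ℝ} (hK : 1 ≤ K) :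
    (if K * edgeScale p t (i, j) < 1 then K * edgeScale p t (i, j) else 1) *
      ((if K * edgeScale p t (i, k) < 1 then K * edgeScale p t (i, k) else 1) *
      (if K * edgeScale p t (j, k) < 1 then K * edgeScale p t (j, k) else 1)) ≤
      K ^ 3 * (oldestWeight p t i * ((threshold p t / j) * (threshold p t / k))) := by
  have hθ := threshold_pos (p := p) ht
  have ha : 0 < threshold p t / i := div_pos hθ (by exact_mod_cast hi)
  have hb : 0 < threshold p t / j := div_pos hθ (by exact_mod_cast hj)
  have hc : 0 < threshold p t / k := div_pos hθ (by exact_mod_cast hk)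
  have hnn : ∀ e : ℕ × ℕ, 1 ≤ e.1 → 1 ≤ e.2 →
      0 ≤ if K * edgeScale p t e < 1 then K * edgeScale p t e else 1 := by
    intro e h1 h2
    have := edgeScale_pos (p := p) ht h1 h2
    split_ifs
    · positivity
    · norm_num
  have key : ∀ l l' : ℝ, 0 ≤ l → l ≤ 1 → 0 ≤ l' → l' ≤ 1 → (1 - p / 2) * (l + l') = 1 →
      (if K * edgeScale p t (i, j) < 1 then K * edgeScale p t (i, j) else 1) *
      ((if K * edgeScale p t (i, k) < 1 then K * edgeScale p t (i, k) else 1) *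
      (if K * edgeScale p t (j, k) < 1 then K * edgeScale p t (j, k) else 1)) ≤
      K ^ 3 * ((threshold p t / i) ^ ((2 - p) * l) *
        ((threshold p t / j) * (threshold p t / k))) := by
    intro l l' hl0 hl1 hl0' hl1' hll
    refine (mul_le_mul (ite_edgeScale_le hp1 ht hi hj hK hl0 hl1)
      (mul_le_mul (ite_edgeScale_le hp1 ht hi hk hK hl0 hl1)
        (ite_edgeScale_le hp1 ht hj hk hK hl0' hl1') (hnn _ hj hk) (by positivity))
      (mul_nonneg (hnn _ hi hk) (hnn _ hj hk)) (by positivity)).trans (le_of_eq ?_)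
    have h1 : (threshold p t / i) ^ ((2 - p) * l) =
        (threshold p t / i) ^ ((1 - p / 2) * l) * (threshold p t / i) ^ ((1 - p / 2) * l) := by
      rw [← rpow_add ha]; congr 1; ring
    have h2 : ∀ z : ℝ, 0 < z → z = z ^ ((1 - p / 2) * l) * z ^ ((1 - p / 2) * l') := by
      intro z hz
      rw [← rpow_add hz, ← mul_add, hll, rpow_one]
    rw [h1]
    conv_rhs => rw [h2 _ hb, h2 _ hc]
    ring
  have h2p : 0 < 2 - p := by linarith
  have hl1 : p / (2 - p) ≤ 1 := by rw [div_le_one h2p]; linarith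
  have hl0 : 0 ≤ p / (2 - p) := by positivity
  have h1 := key (p / (2 - p)) 1 hl0 hl1 zero_le_one le_rfl (by field_simp; ring)
  have h2 := key 1 (p / (2 - p)) zero_le_one le_rfl hl0 hl1 (by field_simp; ring)
  rw [mul_div_cancel₀ _ h2p.ne'] at h1
  rw [mul_one] at h2
  unfold oldestWeight
  rcases min_choice ((threshold p t / i) ^ p) ((threshold p t / i) ^ (2 - p)) with h | h
  · rw [h]; exact h1
  · rw [h]; exact h2

theorem sum_oldestWeight_le (hp0 : 0 < p) (hp1 : p < 1) (ht : 1 ≤ t) :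
    ∑ i ∈ Finset.Icc 1 t, oldestWeight p t i ≤ 3 / (1 - p) * threshold p t := by
  have hθ := threshold_pos (p := p) ht
  have h1p : 0 < 1 - p := by linarith
  have ht1 : (1 : ℝ) ≤ t := by exact_mod_cast ht
  have hθ1 : 1 ≤ threshold p t := one_le_rpow ht1 (div_nonneg h1p.le (by linarith))
  have hθt : threshold p t ≤ t := by
    have h : (1 - p) / (2 - p) ≤ 1 := by rw [div_le_one (by linarith)]; linarith
    simpa [threshold] using rpow_le_rpow_of_exponent_le ht1 h
  set θ := threshold p t with hθdef
  set m := ⌊θ⌋₊ with hm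
  have hm1 : 1 ≤ m := Nat.le_floor (by simpa using hθ1)
  have hmt : m ≤ t := Nat.floor_le_of_le hθt
  have hmθ : (m : ℝ) ≤ θ := Nat.floor_le hθ.le
  have hθm : θ / 2 ≤ m := by
    have h1 := Nat.lt_floor_add_one θ
    have h2 : (1 : ℝ) ≤ m := by exact_mod_cast hm1
    linarith
  have hm0 : (0 : ℝ) < m := by exact_mod_cast hm1
  have hdisj : Finset.Icc 1 t = Finset.Icc 1 m ∪ Finset.Ioc m t := by
    ext i; simp only [Finset.mem_union, Finset.mem_Icc, Finset.mem_Ioc]; omega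
  rw [hdisj, Finset.sum_union (by
    rw [Finset.disjoint_left]; intro i; simp only [Finset.mem_Icc, Finset.mem_Ioc]; omega)]
  have hA : ∑ i ∈ Finset.Icc 1 m, oldestWeight p t i ≤ 1 / (1 - p) * θ := by
    calc _ ≤ ∑ i ∈ Finset.Icc 1 m, θ ^ p * (i : ℝ) ^ (-p) := by
          refine Finset.sum_le_sum fun i _ => (min_le_left _ _).trans (le_of_eq ?_)
          rw [div_rpow hθ.le (Nat.cast_nonneg _), rpow_neg (Nat.cast_nonneg _), div_eq_mul_inv]
      _ ≤ θ ^ p * (θ ^ (1 - p) / (1 - p)) := by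
          rw [← Finset.mul_sum]
          refine mul_le_mul_of_nonneg_left ((sum_Icc_rpow_neg_le hp0.le hp1 m).trans ?_)
            (rpow_nonneg hθ.le _)
          exact div_le_div_of_nonneg_right (rpow_le_rpow hm0.le hmθ h1p.le) h1p.le
      _ = 1 / (1 - p) * (θ ^ p * θ ^ (1 - p)) := by ring
      _ = _ := by rw [← rpow_add hθ, add_sub_cancel, rpow_one]
  have hB : ∑ i ∈ Finset.Ioc m t, oldestWeight p t i ≤ 2 / (1 - p) * θ := by
    calc _ ≤ ∑ i ∈ Finset.Ioc m t, θ ^ (2 - p) * (i : ℝ) ^ (-(1 + (1 - p))) := by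
          refine Finset.sum_le_sum fun i _ => (min_le_right _ _).trans (le_of_eq ?_)
          rw [div_rpow hθ.le (Nat.cast_nonneg _), rpow_neg (Nat.cast_nonneg _), div_eq_mul_inv]
          congr 3; ring
      _ ≤ θ ^ (2 - p) * (2 * θ ^ (-(1 - p)) / (1 - p)) := by
          rw [← Finset.mul_sum]
          refine mul_le_mul_of_nonneg_left ((sum_Ioc_rpow_neg_le h1p hm1 t hmt).trans ?_)
            (rpow_nonneg hθ.le _)
          refine div_le_div_of_nonneg_right ?_ h1p.le
          have h1 : (m : ℝ) ^ (-(1 - p)) ≤ (θ / 2) ^ (-(1 - p)) :=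
            rpow_le_rpow_of_nonpos (by positivity) hθm (by linarith)
          have h2 : (θ / 2) ^ (-(1 - p)) ≤ 2 * θ ^ (-(1 - p)) := by
            rw [div_rpow hθ.le (by norm_num), rpow_neg (by norm_num : (0 : ℝ) ≤ 2), div_inv_eq_mul,
              mul_comm]
            refine mul_le_mul_of_nonneg_right ?_ (rpow_nonneg hθ.le _)
            calc (2 : ℝ) ^ (1 - p) ≤ 2 ^ (1 : ℝ) :=
                  rpow_le_rpow_of_exponent_le (by norm_num) (by linarith)
              _ = 2 := by norm_num
          have h3 : 0 ≤ (t : ℝ) ^ (-(1 - p)) := by positivity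
          linarith
      _ = 2 / (1 - p) * (θ ^ (2 - p) * θ ^ (-(1 - p))) := by ring
      _ = _ := by
          rw [← rpow_add hθ]
          congr 1
          rw [show 2 - p + -(1 - p) = 1 by ring, rpow_one]
  calc _ ≤ 1 / (1 - p) * θ + 2 / (1 - p) * θ := add_le_add hA hB
    _ = _ := by ring

theorem sum_stepError_le (hp0 : 0 < p) (hp1 : p < 1) (ht : 1 ≤ t) :
    ∑ s ∈ Finset.Ico 1 t, stepError (1 - p / 2) (log t + 400) ((t : ℝ) ^ (1 - p)) s ≤
      102 + 24 / (1 - p) := by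
  have ht0 : (0 : ℝ) < t := by exact_mod_cast ht
  have hT : 0 < (t : ℝ) ^ (1 - p) := rpow_pos_of_pos ht0 _
  have hlog : 0 ≤ log t := log_natCast_nonneg t
  have hL : 0 < log t + 400 := by linarith
  have h1p : 0 < 1 - p := by linarith
  have hterm : ∀ s ∈ Finset.Icc 1 t, stepError (1 - p / 2) (log t + 400) ((t : ℝ) ^ (1 - p)) s =
      18 / (log t + 400) * (1 / (s : ℝ)) + 42 * (1 / (s : ℝ) ^ 2) +
        24 / (t : ℝ) ^ (1 - p) * (s : ℝ) ^ (-p) := by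
    intro s hs
    have hs0 : (0 : ℝ) < s := by exact_mod_cast (Finset.mem_Icc.1 hs).1
    have h : ((s : ℝ) * (s : ℝ) ^ (-(1 - p / 2))) ^ 2 = (s : ℝ) ^ p := by
      nth_rewrite 1 [← rpow_one (s : ℝ)]
      rw [← rpow_add hs0, ← rpow_natCast, ← rpow_mul hs0.le]
      congr 1
      push_cast
      ring
    unfold stepError
    rw [h, rpow_neg hs0.le]
    have := (rpow_pos_of_pos hs0 p).ne'
    field_simp
  calc _ ≤ ∑ s ∈ Finset.Icc 1 t, stepError (1 - p / 2) (log t + 400) ((t : ℝ) ^ (1 - p)) s := by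
        refine Finset.sum_le_sum_of_subset_of_nonneg Finset.Ico_subset_Icc_self fun s _ _ => ?_
        unfold stepError
        positivity
    _ = 18 / (log t + 400) * ∑ s ∈ Finset.Icc 1 t, 1 / (s : ℝ) +
          42 * ∑ s ∈ Finset.Icc 1 t, 1 / (s : ℝ) ^ 2 +
          24 / (t : ℝ) ^ (1 - p) * ∑ s ∈ Finset.Icc 1 t, (s : ℝ) ^ (-p) := by
        rw [Finset.sum_congr rfl hterm]
        simp only [Finset.sum_add_distrib, ← Finset.mul_sum]
    _ ≤ 18 / (log t + 400) * (log t + 400) + 42 * 2 +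
          24 / (t : ℝ) ^ (1 - p) * ((t : ℝ) ^ (1 - p) / (1 - p)) := by
        have h1 : ∑ s ∈ Finset.Icc 1 t, 1 / (s : ℝ) ≤ log t + 400 :=
          (sum_Icc_one_div_le t).trans (by linarith)
        have h2 := sum_Icc_one_div_sq_le t
        have h3 := sum_Icc_rpow_neg_le hp0.le hp1 t
        gcongr
    _ = _ := by
        field_simp
        ring

theorem one_le_mul_rpow (hp1 : p < 1) {s : ℕ} (hs : 1 ≤ s) (hst : s ≤ t) :
    1 ≤ (t : ℝ) ^ (1 - p) * s * ((s : ℝ) ^ (-(1 - p / 2))) ^ 2 := by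
  have hs0 : (0 : ℝ) < s := by exact_mod_cast hs
  have h : (s : ℝ) * ((s : ℝ) ^ (-(1 - p / 2))) ^ 2 = ((s : ℝ) ^ (1 - p))⁻¹ := by
    rw [← rpow_natCast, ← rpow_mul hs0.le, ← rpow_neg hs0.le]
    nth_rewrite 1 [← rpow_one (s : ℝ)]
    rw [← rpow_add hs0]
    congr 1
    push_cast
    ring
  rw [mul_assoc, h, ← div_eq_mul_inv, one_le_div (rpow_pos_of_pos hs0 _)]
  exact rpow_le_rpow hs0.le (by exact_mod_cast hst) (by linarith)

theorem edgePotential_one_le {L T : ℝ} {e : ℕ × ℕ} (hL : 1 ≤ L) (hT : 0 < T) (hx : 1 ≤ e.1)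
    (hy : 1 ≤ e.2) :
    edgePotential (1 - p / 2) L T 1 1 (fun x => if x = 1 then 2 else 0) e ≤
      16 * L ^ 2 * (T * ((e.1 : ℝ) ^ (-(1 - p / 2)) * (e.2 : ℝ) ^ (-(1 - p / 2)))) := by
  have hx0 : (0 : ℝ) < e.1 := by exact_mod_cast hx
  have hy0 : (0 : ℝ) < e.2 := by exact_mod_cast hy
  have hL0 : 0 < L := by linarith
  have hd : ∀ x, (0 : ℝ) ≤ if x = 1 then 2 else 0 := fun x : ℕ => by split_ifs <;> norm_num
  have h1 : ∀ x, shiftDeg L 1 (fun x => if x = 1 then 2 else 0) x ≤ 4 * L := by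
    intro x
    unfold shiftDeg
    beta_reduce
    split_ifs <;> linarith
  have h2 : ∀ x, 0 < shiftDeg L 1 (fun x => if x = 1 then 2 else 0) x := shiftDeg_pos hL0 hd
  unfold edgePotential ageWeight
  rw [max_eq_right hx, max_eq_right hy]
  calc _ ≤ T * (((e.1 : ℝ) ^ (-(1 - p / 2)) * (4 * L)) *
          ((e.2 : ℝ) ^ (-(1 - p / 2)) * (4 * L))) := by
        have := h1 e.1
        have := h1 e.2
        have := (h2 e.1).le
        have := (h2 e.2).le
        gcongr
    _ = _ := by ring

end Truncation

namespace PAProcess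

section Triangles

open Real

attribute [local instance] PAProcess.m0 PAProcess.isProb

variable {p : ℝ} (P : PAProcess p) {t : ℕ}

theorem integral_potential_le_prod_edgeScale (hp0 : 0 < p) (hp1 : p < 1) (ht : 1 ≤ t)
    {S : Finset (ℕ × ℕ)} (hS : S.card ≤ 3) (hlt : ∀ e ∈ S, 1 ≤ e.1 ∧ e.1 < e.2) :
    Integrable (P.potential (log t + 400) ((t : ℝ) ^ (1 - p)) S t) P.μ ∧
      ∫ ω, P.potential (log t + 400) ((t : ℝ) ^ (1 - p)) S t ω ∂P.μ ≤
        exp (102 + 24 / (1 - p)) * ∏ e ∈ S, (16 * (log t + 400) ^ 2 * edgeScale p t e) := by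
  have ht0 : (0 : ℝ) < t := by exact_mod_cast ht
  have hT : 0 < (t : ℝ) ^ (1 - p) := rpow_pos_of_pos ht0 _
  have hlog : 0 ≤ log t := log_natCast_nonneg t
  obtain ⟨h1, h2⟩ := P.integral_potential_le hp0 hp1 hT (L := log t + 400) (by linarith) ht
    (fun s hs hst => one_le_mul_rpow hp1 hs hst) hS fun e he => (hlt e he).2
  refine ⟨h1, h2.trans ?_⟩
  have hpos : ∀ e, 0 ≤ edgePotential (1 - p / 2) (log t + 400) ((t : ℝ) ^ (1 - p)) 1 1
      (fun x => if x = 1 then 2 else 0) e := fun e =>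
    (edgePotential_pos hT (by linarith) le_rfl (fun x => by split_ifs <;> norm_num) e).le
  refine mul_le_mul (exp_le_exp.2 (sum_stepError_le hp0 hp1 ht)) ?_
    (Finset.prod_nonneg fun e _ => hpos e) (exp_pos _).le
  refine Finset.prod_le_prod (fun e _ => hpos e) fun e he => ?_
  have := hlt e he
  exact edgePotential_one_le (by linarith) hT (by omega) (by omega)

theorem triangles_le_sum_potential {L T : ℝ} (hT : 0 < T) (hL : 0 < L) (ht : 1 ≤ t)
    (Q : ℕ × ℕ → Prop) (ω : P.Ω) :
    (P.triangles t ω : ℝ) ≤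
      ∑ q ∈ (Finset.Icc 1 t ×ˢ Finset.Icc 1 t ×ˢ Finset.Icc 1 t).filter
        (fun q => q.1 < q.2.1 ∧ q.2.1 < q.2.2),
        P.potential L T (({(q.1, q.2.1), (q.1, q.2.2), (q.2.1, q.2.2)} :
          Finset (ℕ × ℕ)).filter Q) t ω := by
  unfold triangles
  have hsplit : ∀ B : Finset (ℕ × ℕ × ℕ), B.filter (fun q => q.1 < q.2.1 ∧ q.2.1 < q.2.2 ∧
      P.Joined t q.1 q.2.1 ω ∧ P.Joined t q.1 q.2.2 ω ∧ P.Joined t q.2.1 q.2.2 ω) =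
      (B.filter (fun q => q.1 < q.2.1 ∧ q.2.1 < q.2.2)).filter (fun q =>
      P.Joined t q.1 q.2.1 ω ∧ P.Joined t q.1 q.2.2 ω ∧ P.Joined t q.2.1 q.2.2 ω) := by
    intro B
    rw [Finset.filter_filter]
    simp only [and_assoc]
  rw [hsplit, Finset.card_filter]
  push_cast
  refine Finset.sum_le_sum fun q _ => ?_
  split_ifs with h
  · refine P.one_le_potential_of_joined hT hL ht fun e he => ?_
    have he' := Finset.mem_of_mem_filter e he
    simp only [Finset.mem_insert, Finset.mem_singleton] at he'
    rcases he' with rfl | rfl | rfl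
    · exact h.1
    · exact h.2.1
    · exact h.2.2
  · exact P.potential_nonneg hT hL ht ω

theorem integral_triangles_le (hp0 : 0 < p) (hp1 : p < 1) (ht : 1 ≤ t) :
    ∫ ω, (P.triangles t ω : ℝ) ∂P.μ ≤ exp (102 + 24 / (1 - p)) *
      ((16 * (log t + 400) ^ 2) ^ 3 *
        (3 / (1 - p) * threshold p t * (threshold p t * (1 + log t)) ^ 2)) := by
  have ht0 : (0 : ℝ) < t := by exact_mod_cast ht
  have hT : 0 < (t : ℝ) ^ (1 - p) := rpow_pos_of_pos ht0 _
  have hlog : 0 ≤ log t := log_natCast_nonneg t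
  have hθ := threshold_pos (p := p) ht
  set K := 16 * (log t + 400) ^ 2 with hK
  have hK1 : 1 ≤ K := by nlinarith
  have hE0 := exp_pos (102 + 24 / (1 - p))
  set D := (Finset.Icc 1 t ×ˢ Finset.Icc 1 t ×ˢ Finset.Icc 1 t).filter
    (fun q : ℕ × ℕ × ℕ => q.1 < q.2.1 ∧ q.2.1 < q.2.2) with hD
  set R : ℕ × ℕ × ℕ → Finset (ℕ × ℕ) := fun q =>
    ({(q.1, q.2.1), (q.1, q.2.2), (q.2.1, q.2.2)} : Finset (ℕ × ℕ)).filter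
      fun e => K * edgeScale p t e < 1 with hR
  have hw0 : ∀ i, 0 ≤ oldestWeight p t i := fun i => le_min (by positivity) (by positivity)
  have hb0 : ∀ i : ℕ, 0 ≤ threshold p t / i := fun i => by positivity
  have hpot : ∀ q ∈ D, Integrable (P.potential (log t + 400) ((t : ℝ) ^ (1 - p)) (R q) t) P.μ ∧
      ∫ ω, P.potential (log t + 400) ((t : ℝ) ^ (1 - p)) (R q) t ω ∂P.μ ≤
        exp (102 + 24 / (1 - p)) * (K ^ 3 * (oldestWeight p t q.1 *
          ((threshold p t / q.2.1) * (threshold p t / q.2.2)))) := by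
    intro q hq
    obtain ⟨i, j, k⟩ := q
    simp only [hD, Finset.mem_filter, Finset.mem_product, Finset.mem_Icc] at hq
    have hcard : (R (i, j, k)).card ≤ 3 := (Finset.card_filter_le _ _).trans Finset.card_le_three
    obtain ⟨h1, h2⟩ := P.integral_potential_le_prod_edgeScale hp0 hp1 ht hcard fun e he => by
      have he' := Finset.mem_of_mem_filter e he
      simp only [Finset.mem_insert, Finset.mem_singleton] at he'
      rcases he' with rfl | rfl | rfl <;> simp only <;> omega
    refine ⟨h1, h2.trans (mul_le_mul_of_nonneg_left ?_ hE0.le)⟩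
    have hprod : ∏ e ∈ R (i, j, k), (K * edgeScale p t e) =
        (if K * edgeScale p t (i, j) < 1 then K * edgeScale p t (i, j) else 1) *
      ((if K * edgeScale p t (i, k) < 1 then K * edgeScale p t (i, k) else 1) *
      (if K * edgeScale p t (j, k) < 1 then K * edgeScale p t (j, k) else 1)) := by
      rw [hR]
      beta_reduce
      rw [Finset.prod_filter, Finset.prod_insert, Finset.prod_insert, Finset.prod_singleton]
      · simp only [Finset.mem_singleton, Prod.mk.injEq]; omega
      · simp only [Finset.mem_insert, Finset.mem_singleton, Prod.mk.injEq]; omega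
    rw [hprod]
    exact prod_ite_edgeScale_le hp0 hp1 ht (by omega) (by omega) (by omega) hK1
  have hsum1 : ∑ j ∈ Finset.Icc 1 t, threshold p t / j ≤ threshold p t * (1 + log t) := by
    have h := mul_le_mul_of_nonneg_left (sum_Icc_one_div_le t) hθ.le
    rw [Finset.mul_sum] at h
    simpa only [mul_one_div] using h
  have hsum0 : 0 ≤ ∑ j ∈ Finset.Icc 1 t, threshold p t / j := Finset.sum_nonneg fun j _ => hb0 j
  calc _ ≤ ∫ ω, ∑ q ∈ D, P.potential (log t + 400) ((t : ℝ) ^ (1 - p)) (R q) t ω ∂P.μ :=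
        integral_mono_of_nonneg (ae_of_all _ fun ω => Nat.cast_nonneg _)
          (integrable_finsetSum _ fun q hq => (hpot q hq).1)
          (ae_of_all _ fun ω => P.triangles_le_sum_potential hT (by linarith) ht _ ω)
    _ = ∑ q ∈ D, ∫ ω, P.potential (log t + 400) ((t : ℝ) ^ (1 - p)) (R q) t ω ∂P.μ :=
        integral_finsetSum _ fun q hq => (hpot q hq).1
    _ ≤ ∑ q ∈ D, exp (102 + 24 / (1 - p)) * (K ^ 3 * (oldestWeight p t q.1 *
          ((threshold p t / q.2.1) * (threshold p t / q.2.2)))) :=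
        Finset.sum_le_sum fun q hq => (hpot q hq).2
    _ ≤ ∑ q ∈ Finset.Icc 1 t ×ˢ Finset.Icc 1 t ×ˢ Finset.Icc 1 t,
          exp (102 + 24 / (1 - p)) * (K ^ 3 * (oldestWeight p t q.1 *
          ((threshold p t / q.2.1) * (threshold p t / q.2.2)))) :=
        Finset.sum_le_sum_of_subset_of_nonneg (Finset.filter_subset _ _) fun q _ _ =>
          mul_nonneg hE0.le (mul_nonneg (by positivity)
            (mul_nonneg (hw0 _) (mul_nonneg (hb0 _) (hb0 _))))
    _ = exp (102 + 24 / (1 - p)) * (K ^ 3 * ((∑ i ∈ Finset.Icc 1 t, oldestWeight p t i) *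
          (∑ j ∈ Finset.Icc 1 t, threshold p t / j) ^ 2)) := by
        rw [← Finset.mul_sum, ← Finset.mul_sum, sq, Finset.sum_mul_sum, ← Finset.sum_product',
          Finset.sum_mul_sum, ← Finset.sum_product']
    _ ≤ _ := by
        refine mul_le_mul_of_nonneg_left (mul_le_mul_of_nonneg_left ?_ (by positivity)) hE0.le
        exact mul_le_mul (sum_oldestWeight_le hp0 hp1 ht) (pow_le_pow_left₀ hsum0 hsum1 2)
          (by positivity) (by have : 0 < 1 - p := by linarith
                              positivity)

end Triangles

end PAProcess

theorem expected_triangles_upper_bound (p : ℝ) (hp0 : 0 < p) (hp1 : p < 1)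
    (P : PAProcess p) :
    ∃ C : ℝ, 0 < C ∧
      ∀ t : ℕ, 2 ≤ t →
        ∫ ω, (P.triangles t ω : ℝ) ∂P.μ ≤
          C * (t : ℝ) ^ (3 * ((1 - p) / (2 - p))) * Real.log t ^ 8 := by
  have h1p : 0 < 1 - p := by linarith
  refine ⟨Real.exp (102 + 24 / (1 - p)) * (16 ^ 3 * 601 ^ 6 * (3 / (1 - p)) * 9), by positivity,
    fun t ht => (P.integral_triangles_le hp0 hp1 (by omega)).trans ?_⟩
  have ht2 : (2 : ℝ) ≤ t := by exact_mod_cast ht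
  have hlog : 0.69 ≤ Real.log t := by
    have := Real.log_two_gt_d9
    have := Real.log_le_log (by norm_num) ht2
    linarith
  have hθ := threshold_pos (p := p) (t := t) (by omega)
  have h3 : (t : ℝ) ^ (3 * ((1 - p) / (2 - p))) = threshold p t ^ 3 := by
    unfold threshold
    rw [← Real.rpow_natCast, ← Real.rpow_mul (by linarith)]
    congr 1
    push_cast
    ring
  have hl1 : Real.log t + 400 ≤ 601 * Real.log t := by linarith
  have hl2 : 1 + Real.log t ≤ 3 * Real.log t := by linarith
  rw [h3]
  calc _ ≤ Real.exp (102 + 24 / (1 - p)) * ((16 * (601 * Real.log t) ^ 2) ^ 3 *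
        (3 / (1 - p) * threshold p t * (threshold p t * (3 * Real.log t)) ^ 2)) := by
        have : 0 < Real.log t := by linarith
        gcongr
    _ = _ := by ring
end

section
/- For every real q > 1 there exists a constant C > 0, depending only on q, such that for every integer M ≥ 2 and every real N ≥ 1: ∑_{i=1}^{M} ∑_{j=1}^{M} ∑_{k ≥ 1, ijk ≥ N} (i·j·k)^{−q} ≤ C · N^{1−q} · (log M)². -/
open scoped Classical

lemma rpow_neg_le_mul_rpow_sub_rpow {q k : ℝ} (hq : 1 < q) (hk : 1 ≤ k) :
    k ^ (-q) ≤ 2 ^ q / (q - 1) * (k ^ (1 - q) - (k + 1) ^ (1 - q)) := by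
  have hk0 : 0 < k := by linarith
  have hk1 : 0 < k + 1 := by linarith
  have hq1 : 0 < q - 1 := by linarith
  have bernoulli : 1 + (q - 1) / (k + 1) ≤ (k / (k + 1)) ^ (1 - q) := by
    have ht : 0 < k / (k + 1) := by positivity
    rw [Real.rpow_def_of_pos ht]
    have hexp := Real.add_one_le_exp (Real.log (k / (k + 1)) * (1 - q))
    have hlog := mul_le_mul_of_nonneg_left (Real.log_le_sub_one_of_pos ht) hq1.le
    have heq : (q - 1) * (k / (k + 1) - 1) = -((q - 1) / (k + 1)) := by
      field_simp
      ring
    linarith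
  have hdiff : (q - 1) * (k + 1) ^ (-q) ≤ k ^ (1 - q) - (k + 1) ^ (1 - q) := by
    have hp : (k + 1) ^ (1 - q) = (k + 1) * (k + 1) ^ (-q) := by
      rw [sub_eq_add_neg, Real.rpow_add hk1, Real.rpow_one]
    rw [Real.div_rpow hk0.le hk1.le, le_div_iff₀ (by positivity), hp] at bernoulli
    rw [hp]
    have : (1 + (q - 1) / (k + 1)) * ((k + 1) * (k + 1) ^ (-q))
        = (k + 1) * (k + 1) ^ (-q) + (q - 1) * (k + 1) ^ (-q) := by
      field_simp
    linarith
  have hdouble : k ^ (-q) ≤ 2 ^ q * (k + 1) ^ (-q) := by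
    have h : (2 * k) ^ (-q) ≤ (k + 1) ^ (-q) :=
      Real.rpow_le_rpow_of_nonpos hk1 (by linarith) (by linarith)
    calc k ^ (-q) = 2 ^ q * (2 * k) ^ (-q) := by
          rw [Real.mul_rpow (by norm_num) hk0.le, ← mul_assoc, ← Real.rpow_add (by norm_num)]
          simp
      _ ≤ _ := by gcongr
  calc k ^ (-q) ≤ 2 ^ q * (k + 1) ^ (-q) := hdouble
    _ = 2 ^ q / (q - 1) * ((q - 1) * (k + 1) ^ (-q)) := by field_simp
    _ ≤ _ := by gcongr

lemma sum_range_rpow_neg_tail_le {q x : ℝ} (hq : 1 < q) (hx : 0 < x) (n : ℕ) :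
    ∑ k ∈ Finset.range n, (if 1 ≤ k ∧ x ≤ (k : ℝ) then (k : ℝ) ^ (-q) else 0) ≤
      2 ^ q / (q - 1) * x ^ (1 - q) := by
  have hq1 : 0 < q - 1 := by linarith
  set g : ℕ → ℝ := fun k => 2 ^ q / (q - 1) * (max x k) ^ (1 - q) with hg
  have hmax : ∀ k : ℕ, 0 < max x (k : ℝ) := fun k => lt_max_of_lt_left hx
  have hstep : ∀ k : ℕ,
      (if 1 ≤ k ∧ x ≤ (k : ℝ) then (k : ℝ) ^ (-q) else 0) ≤ g k - g (k + 1) := by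
    intro k
    split_ifs with h
    · have := rpow_neg_le_mul_rpow_sub_rpow hq (k := k) (by exact_mod_cast h.1)
      simp only [hg]
      push_cast
      rw [max_eq_right h.2, max_eq_right (by linarith [h.2]), ← mul_sub]
      exact this
    · rw [sub_nonneg]
      simp only [hg]
      refine mul_le_mul_of_nonneg_left ?_ (by positivity)
      refine Real.rpow_le_rpow_of_nonpos (hmax k) ?_ (by linarith)
      gcongr
      simp
  calc _ ≤ ∑ k ∈ Finset.range n, (g k - g (k + 1)) := Finset.sum_le_sum fun k _ => hstep k
    _ = g 0 - g n := Finset.sum_range_sub' g n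
    _ ≤ g 0 := by
      have : 0 ≤ g n := mul_nonneg (by positivity) (Real.rpow_nonneg (hmax n).le _)
      linarith
    _ = _ := by simp [hg, max_eq_left hx.le]

lemma tsum_mul_rpow_neg_tail_le {q N : ℝ} (hq : 1 < q) (hN : 0 < N) {m : ℕ} (hm : 0 < m) :
    ∑' k : ℕ, (if 1 ≤ k ∧ N ≤ ((m * k : ℕ) : ℝ) then ((m * k : ℕ) : ℝ) ^ (-q) else 0) ≤
      2 ^ q / (q - 1) * N ^ (1 - q) * (m : ℝ)⁻¹ := by
  have hm0 : (0 : ℝ) < m := by exact_mod_cast hm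
  refine Real.tsum_le_of_sum_range_le (fun k => by split_ifs <;> positivity) fun n => ?_
  have hterm : ∀ k : ℕ,
      (if 1 ≤ k ∧ N ≤ ((m * k : ℕ) : ℝ) then ((m * k : ℕ) : ℝ) ^ (-q) else 0) =
        (m : ℝ) ^ (-q) * (if 1 ≤ k ∧ N / m ≤ (k : ℝ) then (k : ℝ) ^ (-q) else 0) := by
    intro k
    simp only [div_le_iff₀' hm0, mul_ite, mul_zero, Nat.cast_mul,
      Real.mul_rpow hm0.le k.cast_nonneg]
  simp_rw [hterm]
  rw [← Finset.mul_sum]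
  calc _ ≤ (m : ℝ) ^ (-q) * (2 ^ q / (q - 1) * (N / m) ^ (1 - q)) := by
        gcongr
        exact sum_range_rpow_neg_tail_le hq (by positivity) n
    _ = _ := by
      have hp : (m : ℝ) ^ (1 - q) = m * (m : ℝ) ^ (-q) := by
        rw [sub_eq_add_neg, Real.rpow_add hm0, Real.rpow_one]
      have hmq : (m : ℝ) ^ (-q) ≠ 0 := (Real.rpow_pos_of_pos hm0 _).ne'
      rw [Real.div_rpow hN.le hm0.le, hp]
      field_simp

lemma sum_Icc_inv_le_mul_log {M : ℕ} (hM : 2 ≤ M) :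
    ∑ i ∈ Finset.Icc 1 M, (i : ℝ)⁻¹ ≤ (1 + (Real.log 2)⁻¹) * Real.log M := by
  have h := harmonic_le_one_add_log M
  rw [harmonic_eq_sum_Icc] at h
  push_cast at h
  have hlog2 : 0 < Real.log 2 := Real.log_pos (by norm_num)
  have hlog : Real.log 2 ≤ Real.log M := Real.log_le_log (by norm_num) (by exact_mod_cast hM)
  have : 1 ≤ (Real.log 2)⁻¹ * Real.log M := by
    rw [inv_mul_eq_div, le_div_iff₀ hlog2]
    linarith
  linarith

/-- For every `q > 1` there is `C > 0` (depending only on `q`) such that for every integer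
`M ≥ 2` and every real `N ≥ 1`,
`∑_{i=1}^{M} ∑_{j=1}^{M} ∑_{k ≥ 1, ijk ≥ N} (ijk)^{-q} ≤ C N^{1-q} (log M)²`. -/
theorem triple_sum_tail_bound (q : ℝ) (hq : 1 < q) :
    ∃ C : ℝ, 0 < C ∧
      ∀ M : ℕ, 2 ≤ M → ∀ N : ℝ, 1 ≤ N →
        (∑ i ∈ Finset.Icc 1 M, ∑ j ∈ Finset.Icc 1 M,
            ∑' k : ℕ, (if 1 ≤ k ∧ N ≤ ((i * j * k : ℕ) : ℝ)
              then ((i * j * k : ℕ) : ℝ) ^ (-q) else 0)) ≤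
          C * N ^ (1 - q) * Real.log M ^ 2 := by
  have hq1 : 0 < q - 1 := by linarith
  have hlog2 : 0 < Real.log 2 := Real.log_pos (by norm_num)
  refine ⟨2 ^ q / (q - 1) * (1 + (Real.log 2)⁻¹) ^ 2, by positivity, fun M hM N hN => ?_⟩
  have hN0 : 0 < N := by linarith
  calc _ ≤ ∑ i ∈ Finset.Icc 1 M, ∑ j ∈ Finset.Icc 1 M,
        2 ^ q / (q - 1) * N ^ (1 - q) * ((i * j : ℕ) : ℝ)⁻¹ := by
        refine Finset.sum_le_sum fun i hi => Finset.sum_le_sum fun j hj => ?_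
        exact tsum_mul_rpow_neg_tail_le hq hN0
          (Nat.mul_pos (Finset.mem_Icc.1 hi).1 (Finset.mem_Icc.1 hj).1)
    _ = 2 ^ q / (q - 1) * N ^ (1 - q) * (∑ i ∈ Finset.Icc 1 M, (i : ℝ)⁻¹) ^ 2 := by
        rw [sq, Finset.sum_mul_sum]
        simp_rw [Finset.mul_sum, Nat.cast_mul, mul_inv]
    _ ≤ 2 ^ q / (q - 1) * N ^ (1 - q) * ((1 + (Real.log 2)⁻¹) * Real.log M) ^ 2 := by
        gcongr
        exact sum_Icc_inv_le_mul_log hM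
    _ = _ := by ring
end

section
/- For every real q > 1 there exists a constant C > 0, depending only on q, such that for every integer M ≥ 2 and every real N ≥ 1: ∑_{i=1}^{M} ∑_{j ≥ 1, ij ≥ N} (i·j)^{−q} ≤ C · N^{1−q} · log M. -/
open scoped Classical

/-- A discrete derivative estimate: `y ^ (-q)` is controlled by the decrement of `y ^ (1 - q)`. -/
lemma mul_rpow_neg_le_rpow_sub_rpow {q y h : ℝ} (hq : 1 < q) (hh : 0 < h) (hhy : h ≤ y) :
    h * y ^ (-q) ≤ 2 ^ q / (q - 1) * (y ^ (1 - q) - (y + h) ^ (1 - q)) := by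
  have hy : 0 < y := hh.trans_le hhy
  have hz : 0 < y + h := by positivity
  have hq' : 0 < q - 1 := by linarith
  have hlog : h / (y + h) ≤ Real.log ((y + h) / y) := by
    have := Real.one_sub_inv_le_log_of_pos (div_pos hz hy)
    rw [inv_div] at this
    convert this using 1
    field_simp
    ring
  have hratio : y ^ (1 - q) =
      (y + h) ^ (1 - q) * Real.exp ((q - 1) * Real.log ((y + h) / y)) := by
    rw [Real.rpow_def_of_pos hy, Real.rpow_def_of_pos hz, ← Real.exp_add,
      Real.log_div hz.ne' hy.ne']
    congr 1
    ring
  have hexp : 1 + (q - 1) * (h / (y + h)) ≤ Real.exp ((q - 1) * Real.log ((y + h) / y)) := by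
    have h₁ := Real.add_one_le_exp ((q - 1) * Real.log ((y + h) / y))
    have h₂ := mul_le_mul_of_nonneg_left hlog hq'.le
    linarith
  have hdiff : (q - 1) * (h * (y + h) ^ (-q)) ≤ y ^ (1 - q) - (y + h) ^ (1 - q) := by
    have h₁ := mul_le_mul_of_nonneg_left hexp (Real.rpow_pos_of_pos hz (1 - q)).le
    rw [← hratio] at h₁
    have h₂ : (y + h) ^ (1 - q) = (y + h) * (y + h) ^ (-q) := by
      rw [sub_eq_add_neg, Real.rpow_add hz, Real.rpow_one]
    have h₃ : (y + h) ^ (1 - q) * (h / (y + h)) = h * (y + h) ^ (-q) := by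
      rw [h₂]
      field_simp
    linear_combination h₁ - (q - 1) * h₃
  have hdouble : y ^ (-q) ≤ 2 ^ q * (y + h) ^ (-q) := by
    calc y ^ (-q) = 2 ^ q * (2 * y) ^ (-q) := by
          rw [Real.mul_rpow two_pos.le hy.le, ← mul_assoc, ← Real.rpow_add two_pos,
            add_neg_cancel, Real.rpow_zero, one_mul]
      _ ≤ 2 ^ q * (y + h) ^ (-q) := by
          gcongr ?_ * ?_
          exact Real.rpow_le_rpow_of_nonpos hz (by linarith) (by linarith)
  calc h * y ^ (-q) ≤ h * (2 ^ q * (y + h) ^ (-q)) := by gcongr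
    _ = 2 ^ q / (q - 1) * ((q - 1) * (h * (y + h) ^ (-q))) := by
        field_simp
    _ ≤ _ := by gcongr

/-- The tail `∑_{j ≥ 1, ij ≥ N} (ij)^{-q}` over multiples of `i` is `O(N^{1-q} / i)`. -/
lemma tsum_multiples_tail_le {q N : ℝ} (hq : 1 < q) (hN : 0 < N) {i : ℕ} (hi : 0 < i) :
    ∑' j : ℕ, (if 1 ≤ j ∧ N ≤ ((i * j : ℕ) : ℝ) then ((i * j : ℕ) : ℝ) ^ (-q) else 0) ≤
      2 ^ q / (q - 1) * N ^ (1 - q) * (i : ℝ)⁻¹ := by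
  have hi' : (0 : ℝ) < i := by exact_mod_cast hi
  have hq' : 0 < q - 1 := by linarith
  set g : ℕ → ℝ := fun j ↦ max ((i * j : ℕ) : ℝ) N ^ (1 - q) with hg
  have hterm (j : ℕ) :
      (if 1 ≤ j ∧ N ≤ ((i * j : ℕ) : ℝ) then ((i * j : ℕ) : ℝ) ^ (-q) else 0) ≤
        2 ^ q / (q - 1) * (i : ℝ)⁻¹ * (g j - g (j + 1)) := by
    split_ifs with h
    · have hle : ((i * j : ℕ) : ℝ) ≤ ((i * (j + 1) : ℕ) : ℝ) := by
        exact_mod_cast Nat.mul_le_mul_left i j.le_succ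
      have hij : (i : ℝ) ≤ ((i * j : ℕ) : ℝ) := by
        exact_mod_cast Nat.le_mul_of_pos_right i h.1
      have key := mul_rpow_neg_le_rpow_sub_rpow hq hi' hij
      simp only [hg]
      rw [max_eq_left h.2, max_eq_left (h.2.trans hle)]
      have hsucc : ((i * (j + 1) : ℕ) : ℝ) = ((i * j : ℕ) : ℝ) + i := by
        push_cast
        ring
      rw [hsucc, mul_right_comm, ← div_eq_mul_inv, le_div_iff₀ hi', mul_comm]
      exact key
    · have hanti : g (j + 1) ≤ g j := by
        refine Real.rpow_le_rpow_of_nonpos (lt_max_of_lt_right hN) ?_ (by linarith)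
        gcongr
        exact j.le_succ
      have := sub_nonneg.2 hanti
      positivity
  refine Real.tsum_le_of_sum_range_le (fun j ↦ by positivity) fun n ↦ ?_
  have hg₀ : g 0 = N ^ (1 - q) := by simp [hg, hN.le]
  have hgn : 0 ≤ g n := Real.rpow_nonneg (hN.le.trans (le_max_right _ _)) _
  calc _ ≤ ∑ j ∈ Finset.range n, 2 ^ q / (q - 1) * (i : ℝ)⁻¹ * (g j - g (j + 1)) :=
        Finset.sum_le_sum fun j _ ↦ hterm j
    _ = 2 ^ q / (q - 1) * (i : ℝ)⁻¹ * (g 0 - g n) := by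
        rw [← Finset.mul_sum, Finset.sum_range_sub']
    _ ≤ 2 ^ q / (q - 1) * (i : ℝ)⁻¹ * N ^ (1 - q) := by
        gcongr
        linarith
    _ = _ := by ring

/-- For every `q > 1` there is `C > 0` (depending only on `q`) such that for every integer
`M ≥ 2` and every real `N ≥ 1`,
`∑_{i=1}^{M} ∑_{j ≥ 1, ij ≥ N} (ij)^{-q} ≤ C N^{1-q} log M`. -/
theorem double_sum_tail_bound (q : ℝ) (hq : 1 < q) :
    ∃ C : ℝ, 0 < C ∧
      ∀ M : ℕ, 2 ≤ M → ∀ N : ℝ, 1 ≤ N →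
        (∑ i ∈ Finset.Icc 1 M,
            ∑' j : ℕ, (if 1 ≤ j ∧ N ≤ ((i * j : ℕ) : ℝ)
              then ((i * j : ℕ) : ℝ) ^ (-q) else 0)) ≤
          C * N ^ (1 - q) * Real.log M := by
  have hq' : 0 < q - 1 := by linarith
  have h2 : 0 < Real.log 2 := Real.log_pos one_lt_two
  refine ⟨2 ^ q / (q - 1) * (1 + (Real.log 2)⁻¹), by positivity, fun M hM N hN ↦ ?_⟩
  have hN' : 0 < N := by linarith
  calc _ ≤ ∑ i ∈ Finset.Icc 1 M, 2 ^ q / (q - 1) * N ^ (1 - q) * (i : ℝ)⁻¹ :=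
        Finset.sum_le_sum fun i hi ↦ tsum_multiples_tail_le hq hN' (Finset.mem_Icc.1 hi).1
    _ = 2 ^ q / (q - 1) * N ^ (1 - q) * ∑ i ∈ Finset.Icc 1 M, (i : ℝ)⁻¹ := by
        rw [Finset.mul_sum]
    _ ≤ 2 ^ q / (q - 1) * N ^ (1 - q) * ((1 + (Real.log 2)⁻¹) * Real.log M) := by
        gcongr
        exact sum_Icc_inv_le_mul_log hM
    _ = _ := by ring
end
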